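/- arXiv:2506.22144 — 3 statements merged into one kernel-verified Lean document; each statement's English description precedes it below -/
import Mathlib

section
/- Let P be a Wait-Only protocol with uncoverable state q_u and final state q_f ∈ Q_W, and let V_P be the associated VASS. Then there exist an initial configuration C of P and a configuration C' such that C →* C' and C'(e) = q_f for all e ∈ [1, ||C'||] if and only if (s_0, 0) ⇝* (s_f, 0) in V_P. Consequently, the synchronization problem for Wait-Only protocols reduces to reachability in V_P and is decidable. -/
set_option maxHeartbeats 1000000

inductive Act (M : Type) where
  | send : M → Act M
  | recv : M → Act M

structure Protocol (Q M : Type) where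
  qin : Q
  T : Set (Q × Act M × Q)

namespace Protocol

variable {Q M : Type}

/-- Messages receivable from state `q`. -/
def R (P : Protocol Q M) (q : Q) : Set M := {a | ∃ q', (q, Act.recv a, q') ∈ P.T}

/-- `q` has an outgoing reception transition. -/
def isWaiting (P : Protocol Q M) (q : Q) : Prop := ∃ a q', (q, Act.recv a, q') ∈ P.T

/-- The set of waiting states. -/
def QW (P : Protocol Q M) : Set Q := {q | P.isWaiting q}

/-- The set of action states. -/
def QA (P : Protocol Q M) : Set Q := {q | ¬ P.isWaiting q}

/-- Wait-Only protocol: every state has no receptions or no broadcasts; the initial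
state is an action state; there is no broadcast self-loop. -/
def WaitOnly (P : Protocol Q M) : Prop :=
  (∀ q : Q, ¬ P.isWaiting q ∨ ¬ ∃ a q', (q, Act.send a, q') ∈ P.T) ∧
  ¬ P.isWaiting P.qin ∧
  ∀ q a, (q, Act.send a, q) ∉ P.T

/-- `qu` is an uncoverable state. -/
def Uncoverable (P : Protocol Q M) (qu : Q) : Prop :=
  (∀ q α q', (q, α, q') ∈ P.T → q ≠ qu ∧ q' ≠ qu) ∧ qu ≠ P.qin

/-- One broadcast step, performed by process `e` via transition `t`. -/
def Step (P : Protocol Q M) {n : ℕ} (e : Fin n) (t : Q × Act M × Q) (C C' : Fin n → Q) : Prop :=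
  ∃ q a q', t = (q, Act.send a, q') ∧ t ∈ P.T ∧ C e = q ∧ C' e = q' ∧
    ∀ e' : Fin n, e' ≠ e →
      ((C e', Act.recv a, C' e') ∈ P.T ∨ (a ∉ P.R (C e') ∧ C' e' = C e'))

def StepAny (P : Protocol Q M) {n : ℕ} (C C' : Fin n → Q) : Prop :=
  ∃ e t, P.Step e t C C'

def Reach (P : Protocol Q M) {n : ℕ} : (Fin n → Q) → (Fin n → Q) → Prop :=
  Relation.ReflTransGen P.StepAny

def Initial (P : Protocol Q M) {n : ℕ} (C : Fin n → Q) : Prop := ∀ e, C e = P.qin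

end Protocol

/-- A finite or infinite execution: `len` is the number of configurations (`⊤` = infinite);
configurations beyond the length are irrelevant. -/
structure Exec {Q M : Type} (P : Protocol Q M) (n : ℕ) where
  npos : 0 < n
  len : ℕ∞
  len_pos : 1 ≤ len
  conf : ℕ → Fin n → Q
  init : P.Initial (conf 0)
  step : ∀ i : ℕ, ((i : ℕ∞) + 1) < len → P.StepAny (conf i) (conf (i + 1))

namespace Exec

variable {Q M : Type} {P : Protocol Q M} {n : ℕ}

open Classical in
/-- First moment `k ≥ j` (within the execution) at which process `e` is in an action
state; `|ρ|` if there is none. -/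
noncomputable def nextIdx (ρ : Exec P n) (j : ℕ) (e : Fin n) : ℕ∞ :=
  if h : ∃ k : ℕ, j ≤ k ∧ (k : ℕ∞) < ρ.len ∧ ¬ P.isWaiting (ρ.conf k e)
  then (Nat.find h : ℕ∞)
  else ρ.len

open Classical in
/-- The next action state of process `e` after `j`; the uncoverable state `qu` if none. -/
noncomputable def nextSt (qu : Q) (ρ : Exec P n) (j : ℕ) (e : Fin n) : Q :=
  if h : ∃ k : ℕ, j ≤ k ∧ (k : ℕ∞) < ρ.len ∧ ¬ P.isWaiting (ρ.conf k e)
  then ρ.conf (Nat.find h) e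
  else qu

noncomputable def next (qu : Q) (ρ : Exec P n) (j : ℕ) (e : Fin n) : Q × ℕ∞ :=
  (nextSt qu ρ j e, nextIdx ρ j e)

/-- Well-formed executions. -/
def WellFormed (qu : Q) (ρ : Exec P n) : Prop :=
  ∀ i : ℕ, (i : ℕ∞) < ρ.len → ∀ e1 e2 : Fin n,
    ρ.conf i e1 = ρ.conf i e2 → P.isWaiting (ρ.conf i e1) →
    nextSt qu ρ i e1 = nextSt qu ρ i e2 →
    ∀ k : ℕ, i ≤ k → (k : ℕ∞) ≤ nextIdx ρ i e1 → ρ.conf k e1 = ρ.conf k e2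

/-- The set of indices at which some process currently waiting will reach action state `qa`. -/
def nextSet (qu : Q) (ρ : Exec P n) (j : ℕ) (qa : Q) : Set ℕ :=
  {i | ∃ e : Fin n, P.isWaiting (ρ.conf j e) ∧ next qu ρ j e = (qa, (i : ℕ∞))}

end Exec

structure VASS (L X : Type) where
  init : L
  Δ : Set (L × (X → ℤ) × L)

namespace VASS

variable {L X : Type}

/-- One VASS step (counters stay in ℕ by typing). -/
def Step (V : VASS L X) (c c' : L × (X → ℕ)) : Prop :=
  ∃ δ, (c.1, δ, c'.1) ∈ V.Δ ∧ ∀ x, (c'.2 x : ℤ) = (c.2 x : ℤ) + δ x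

def Reach (V : VASS L X) : (L × (X → ℕ)) → (L × (X → ℕ)) → Prop :=
  Relation.ReflTransGen V.Step

end VASS

/-- A summary: a print (set of waiting states), an exit state and an identifier. -/
structure Summary (Q : Type) where
  pr : Set Q
  exit : Q
  id : ℕ

namespace BP

variable {Q M : Type}

/-- `|Q_W|`. -/
noncomputable def nW (P : Protocol Q M) : ℕ := P.QW.ncard

def ValidSummary (P : Protocol Q M) (S : Summary Q) : Prop :=
  S.pr ⊆ P.QW ∧ S.exit ∈ P.QA ∧ 1 ≤ S.id ∧ S.id ≤ nW P + 1

/-- Coherent sets of summaries. -/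
def Coherent (P : Protocol Q M) (SS : Set (Summary Q)) : Prop :=
  (∀ S ∈ SS, ValidSummary P S) ∧
  ∀ S1 ∈ SS, ∀ S2 ∈ SS, S1 ≠ S2 → S1.exit = S2.exit →
    S1.id ≠ S2.id ∧ S1.pr ∩ S2.pr = ∅

/-- Labels of a set of summaries. -/
def labs (SS : Set (Summary Q)) : Set (Q × ℕ) := (fun S => (S.exit, S.id)) '' SS

/-- `σ` describes a legal reaction of each state of `pr` to the broadcast of `b`. -/
def RecvFun (P : Protocol Q M) (b : M) (pr : Set Q) (σ : Q → Q) : Prop :=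
  ∀ p ∈ pr, (p, Act.recv b, σ p) ∈ P.T ∨ (b ∉ P.R p ∧ σ p = p)

/-- `S ⟶^t S'`. -/
def SummStep (P : Protocol Q M) (t : Q × Act M × Q) (S S' : Summary Q) : Prop :=
  ∃ q b q', t = (q, Act.send b, q') ∧ t ∈ P.T ∧
    ∃ σ : Q → Q, RecvFun P b S.pr σ ∧ S'.exit = S.exit ∧ S'.id = S.id ∧
      S'.pr = σ '' S.pr ∧ σ '' S.pr ⊆ P.QW

/-- `S ⟶^{t,+q'} S'`. -/
def SummStepJoin (P : Protocol Q M) (t : Q × Act M × Q) (S S' : Summary Q) : Prop :=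
  ∃ q b q', t = (q, Act.send b, q') ∧ t ∈ P.T ∧ q' ∈ P.QW ∧
    ∃ σ : Q → Q, RecvFun P b S.pr σ ∧ S'.exit = S.exit ∧ S'.id = S.id ∧
      S'.pr = σ '' S.pr ∪ {q'} ∧ σ '' S.pr ∪ {q'} ⊆ P.QW

/-- `S ⟶^t Done`. -/
def SummStepDone (P : Protocol Q M) (t : Q × Act M × Q) (S : Summary Q) : Prop :=
  ∃ q b q', t = (q, Act.send b, q') ∧ t ∈ P.T ∧
    ∃ σ : Q → Q, RecvFun P b S.pr σ ∧ σ '' S.pr = {S.exit}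

/-- `S` steps to `some S'` or to `Done` (encoded as `none`). -/
def stepsTo (P : Protocol Q M) (t : Q × Act M × Q) (S : Summary Q) :
    Option (Summary Q) → Prop
  | some S' => SummStep P t S S'
  | none => SummStepDone P t S

inductive CtrBase (Q : Type) where
  | st : Q → CtrBase Q
  | sm : Q → ℕ → CtrBase Q

def ValidCtr (P : Protocol Q M) : CtrBase Q → Prop
  | .st q => q ∈ P.QA
  | .sm q k => q ∈ P.QA ∧ 1 ≤ k ∧ k ≤ nW P + 1

/-- The counters of the VASS built from `P`. -/
abbrev Ctr (P : Protocol Q M) := {x : CtrBase Q // ValidCtr P x}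

open Classical in
/-- Characteristic (unit) vector of a counter. -/
noncomputable def chi (P : Protocol Q M) (x : CtrBase Q) : Ctr P → ℤ :=
  fun y => if y.val = x then 1 else 0

/-- The relation `(SS, δ, SS') ∈ Δ_t`. -/
def DeltaT (P : Protocol Q M) (t : Q × Act M × Q) (SS : Set (Summary Q))
    (δ : Ctr P → ℤ) (SS' : Set (Summary Q)) : Prop :=
  Coherent P SS ∧ Coherent P SS' ∧
  ∃ q a q', t = (q, Act.send a, q') ∧ t ∈ P.T ∧
  ((q' ∈ P.QA ∧
      (∃ g : Summary Q → Option (Summary Q),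
        (∀ S ∈ SS, stepsTo P t S (g S)) ∧
        SS' = {S' | ∃ S ∈ SS, g S = some S'}) ∧
      δ = fun y => chi P (.st q') y - chi P (.st q) y) ∨
   (q' ∈ P.QW ∧
      ∃ S0 ∈ SS, ∃ S0' : Summary Q, SummStepJoin P t S0 S0' ∧
      (∃ g : Summary Q → Option (Summary Q),
        (∀ S ∈ SS, S ≠ S0 → stepsTo P t S (g S)) ∧
        SS' = insert S0' {S' | ∃ S ∈ SS, S ≠ S0 ∧ g S = some S'}) ∧
      δ = fun y => chi P (.sm S0.exit S0.id) y - chi P (.st q) y) ∨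
   (q' ∈ P.QW ∧
      ∃ qa ∈ P.QA, ∃ k : ℕ, 1 ≤ k ∧ k ≤ nW P + 1 ∧ (qa, k) ∉ labs SS ∧
      (∃ g : Summary Q → Option (Summary Q),
        (∀ S ∈ SS, stepsTo P t S (g S)) ∧
        SS' = insert (Summary.mk {q'} qa k) {S' | ∃ S ∈ SS, g S = some S'}) ∧
      δ = fun y => chi P (.sm qa k) y - chi P (.st q) y))

/-- The relation `(SS, δ, SS) ∈ Δ_e`. -/
def DeltaE (P : Protocol Q M) (SS : Set (Summary Q)) (δ : Ctr P → ℤ) : Prop :=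
  Coherent P SS ∧ ∃ q ∈ P.QA, ∃ k : ℕ, 1 ≤ k ∧ k ≤ nW P + 1 ∧ (q, k) ∉ labs SS ∧
    δ = fun y => chi P (.st q) y - chi P (.sm q k) y

/-- Locations of the VASS `V_P` (final state a waiting state). -/
inductive LocW (Q : Type) where
  | s0 : LocW Q
  | sf : LocW Q
  | co : Set (Summary Q) → LocW Q

/-- The VASS `V_P` associated to `P`, `q_u`, and a final waiting state `q_f`. -/
noncomputable def VP (P : Protocol Q M) (qu qf : Q) : VASS (LocW Q) (Ctr P) where
  init := .s0
  Δ := {d |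
    d = (.s0, chi P (.st P.qin), .s0) ∨
    d = (.s0, 0, .co ∅) ∨
    d = (LocW.co {Summary.mk {qf} qu 1}, 0, .sf) ∨
    d = (.sf, fun y => -(chi P (.sm qu 1) y), .sf) ∨
    (∃ t SS δ SS', d = (.co SS, δ, .co SS') ∧ DeltaT P t SS δ SS') ∨
    (∃ SS δ, d = (.co SS, δ, .co SS) ∧ DeltaE P SS δ)}

/-- `C ∈ ⟦(SS, v)⟧`. -/
def Implements (P : Protocol Q M) (SS : Set (Summary Q)) (v : Ctr P → ℕ)
    {n : ℕ} (C : Fin n → Q) : Prop :=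
  ∃ f : Fin n → Ctr P,
    (∀ x : Ctr P, {e : Fin n | f e = x}.ncard = v x) ∧
    (∀ e q, (f e).val = CtrBase.st q → C e = q) ∧
    (∀ e q k pr, (f e).val = CtrBase.sm q k → Summary.mk pr q k ∈ SS → C e ∈ pr ∪ {q}) ∧
    (∀ e q k, (f e).val = CtrBase.sm q k → (q, k) ∉ labs SS → C e = q)

end BP


namespace BP

variable {Q M : Type}

/-- `c'` is a possible reaction of a process in state `c` to the broadcast of `b`. -/
def React (P : Protocol Q M) (b : M) (c c' : Q) : Prop :=
  (c, Act.recv b, c') ∈ P.T ∨ (b ∉ P.R c ∧ c' = c)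

theorem React.eq_of_mem_QA {P : Protocol Q M} {b : M} {c c' : Q} (h : React P b c c')
    (hc : c ∈ P.QA) : c' = c := by
  rcases h with h | h
  · exact absurd ⟨b, c', h⟩ hc
  · exact h.2

theorem react_self_of_mem_QA {P : Protocol Q M} {c : Q} (b : M) (hc : c ∈ P.QA) :
    React P b c c :=
  Or.inr ⟨fun ⟨q', h⟩ => hc ⟨b, q', h⟩, rfl⟩

theorem not_mem_QA_of_mem_QW {P : Protocol Q M} {c : Q} (h : c ∈ P.QW) : c ∉ P.QA :=
  fun h' => h' h

theorem mem_QA_of_send {P : Protocol Q M} (hWO : P.WaitOnly) {q q' : Q} {a : M}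
    (h : (q, Act.send a, q') ∈ P.T) : q ∈ P.QA :=
  (hWO.1 q).resolve_right fun hn => hn ⟨a, q', h⟩

theorem uncoverable_mem_QA {P : Protocol Q M} {qu : Q} (hqu : P.Uncoverable qu) : qu ∈ P.QA :=
  fun ⟨_, _, h⟩ => (hqu.1 _ _ _ h).1 rfl

theorem ne_uncoverable_of_reach {P : Protocol Q M} {qu : Q} (hqu : P.Uncoverable qu) {n : ℕ}
    {C C' : Fin n → Q} (hC : P.Initial C) (h : P.Reach C C') (e : Fin n) : C' e ≠ qu := by
  induction h generalizing e with
  | refl => rw [hC e]; exact hqu.2.symm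
  | tail _ hs ih =>
    obtain ⟨e0, t, q, a, q', rfl, ht, -, h2, h3⟩ := hs
    by_cases he : e = e0
    · subst he
      rw [h2]
      exact (hqu.1 _ _ _ ht).2
    · rcases h3 e he with h | h
      · exact (hqu.1 _ _ _ h).2
      · rw [h.2]
        exact ih e

/-! ### Counting processes by counter -/

open Classical in
/-- The counter valuation induced by an assignment of processes to counters. -/
noncomputable def countOf (P : Protocol Q M) {n : ℕ} (f : Fin n → CtrBase Q) (x : Ctr P) : ℕ :=
  (Finset.univ.filter fun e => f e = x.val).card

theorem countOf_update (P : Protocol Q M) {n : ℕ} (f : Fin n → CtrBase Q) (e : Fin n)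
    (y : CtrBase Q) (x : Ctr P) :
    (countOf P (Function.update f e y) x : ℤ)
      = countOf P f x + (chi P y x - chi P (f e) x) := by
  classical
  have key : ∀ g : Fin n → CtrBase Q, (countOf P g x : ℤ)
      = (if g e = x.val then 1 else 0)
        + ∑ e' ∈ Finset.univ.erase e, if g e' = x.val then (1 : ℤ) else 0 := by
    intro g
    rw [Finset.add_sum_erase _ (fun e' => if g e' = x.val then (1 : ℤ) else 0)
      (Finset.mem_univ e)]
    simp [countOf]
  rw [key, key f, Finset.sum_congr rfl
    (g := fun e' => if f e' = x.val then (1 : ℤ) else 0)]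
  · simp only [Function.update_self, chi, eq_comm (a := x.val)]
    ring
  · intro e' he'
    rw [Function.update_of_ne (Finset.ne_of_mem_erase he')]

theorem exists_of_countOf_pos {P : Protocol Q M} {n : ℕ} {f : Fin n → CtrBase Q} {x : Ctr P}
    (h : 0 < countOf P f x) : ∃ e, f e = x.val := by
  classical
  obtain ⟨e, he⟩ := Finset.card_pos.1 h
  exact ⟨e, (Finset.mem_filter.1 he).2⟩

theorem countOf_pos {P : Protocol Q M} {n : ℕ} {f : Fin n → CtrBase Q} {x : Ctr P}
    {e : Fin n} (h : f e = x.val) : 0 < countOf P f x := by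
  classical
  exact Finset.card_pos.2 ⟨e, Finset.mem_filter.2 ⟨Finset.mem_univ _, h⟩⟩

open Classical in
/-- The valuation with value `m` on the counter `y` and `0` elsewhere. -/
noncomputable def single (P : Protocol Q M) (y : CtrBase Q) (m : ℕ) (x : Ctr P) : ℕ :=
  if x.val = y then m else 0

theorem single_succ (P : Protocol Q M) (y : CtrBase Q) (m : ℕ) (x : Ctr P) :
    (single P y (m + 1) x : ℤ) = single P y m x + chi P y x := by
  unfold single chi
  split <;> simp

theorem single_zero (P : Protocol Q M) (y : CtrBase Q) : single P y 0 = 0 := by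
  funext x
  simp [single]

theorem countOf_const (P : Protocol Q M) (n : ℕ) (y : CtrBase Q) :
    countOf P (fun _ : Fin n => y) = single P y n := by
  classical
  funext x
  by_cases h : x.val = y
  · simp [countOf, single, h]
  · simp [countOf, single, h, eq_comm (a := y)]

/-! ### From runs of the VASS to executions -/

/-- `c` is an admissible state for a process counted by `x` at location `SS`. -/
def StateOK (SS : Set (Summary Q)) : CtrBase Q → Q → Prop
  | .st q, c => c = q
  | .sm q k, c => c = q ∨ ∃ S ∈ SS, S.exit = q ∧ S.id = k ∧ c ∈ S.pr

/-- The configuration `(SS, v)` is realized by a reachable configuration of `P`. -/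
structure Realized (P : Protocol Q M) {n : ℕ} (SS : Set (Summary Q)) (C : Fin n → Q)
    (f : Fin n → CtrBase Q) : Prop where
  reach : ∃ C0, P.Initial C0 ∧ P.Reach C0 C
  valid : ∀ e, ValidCtr P (f e)
  ok : ∀ e, StateOK SS (f e) (C e)

/-- Every state of a print of `SS` can react to `b` so as to follow its summary in `SS'`. -/
def Follows (P : Protocol Q M) (b : M) (SS SS' : Set (Summary Q)) : Prop :=
  ∀ S ∈ SS, ∀ c ∈ S.pr, ∃ c', React P b c c' ∧
    (c' = S.exit ∨ ∃ S' ∈ SS', S'.exit = S.exit ∧ S'.id = S.id ∧ c' ∈ S'.pr)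

theorem Realized.step {P : Protocol Q M} {n : ℕ} {SS SS' : Set (Summary Q)}
    {C : Fin n → Q} {f : Fin n → CtrBase Q} (h : Realized P SS C f) {q q' : Q} {b : M}
    (ht : (q, Act.send b, q') ∈ P.T) (hF : Follows P b SS SS') {e0 : Fin n}
    (he0 : f e0 = .st q) {y : CtrBase Q} (hy : ValidCtr P y) (hyq : StateOK SS' y q') :
    ∃ C', Realized P SS' C' (Function.update f e0 y) := by
  have key : ∀ e, ∃ c', React P b (C e) c' ∧ StateOK SS' (f e) c' := by
    intro e
    have hv := h.valid e
    have ho := h.ok e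
    cases hfe : f e with
    | st r =>
      rw [hfe] at hv ho
      have ho' : C e = r := ho
      rw [ho']
      exact ⟨r, react_self_of_mem_QA b hv, rfl⟩
    | sm r k =>
      rw [hfe] at hv ho
      rcases ho with ho | ⟨S, hS, rfl, rfl, hc⟩
      · rw [ho]
        exact ⟨r, react_self_of_mem_QA b hv.1, Or.inl rfl⟩
      · obtain ⟨c', h1, h2⟩ := hF S hS _ hc
        exact ⟨c', h1, h2⟩
  choose c' hc1 hc2 using key
  obtain ⟨C0, hC0, hR⟩ := h.reach
  refine ⟨Function.update c' e0 q', ⟨C0, hC0, hR.tail ⟨e0, _, q, b, q', rfl, ht, ?_, ?_, ?_⟩⟩,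
    ?_, ?_⟩
  · have := h.ok e0
    rw [he0] at this
    exact this
  · simp
  · intro e he
    rw [Function.update_of_ne he]
    exact hc1 e
  · intro e
    by_cases he : e = e0
    · subst he; simpa using hy
    · simpa [Function.update_of_ne he] using h.valid e
  · intro e
    by_cases he : e = e0
    · subst he; simpa using hyq
    · simpa [Function.update_of_ne he] using hc2 e

theorem follows_of_stepsTo {P : Protocol Q M} {q q' : Q} {b : M} {S : Summary Q}
    {o : Option (Summary Q)} (h : stepsTo P (q, Act.send b, q') S o) {c : Q} (hc : c ∈ S.pr) :
    ∃ c', React P b c c' ∧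
      (c' = S.exit ∨ ∃ S', o = some S' ∧ S'.exit = S.exit ∧ S'.id = S.id ∧ c' ∈ S'.pr) := by
  cases o with
  | none =>
    obtain ⟨_, _, _, heq, -, σ, h1, h2⟩ := h
    cases heq
    refine ⟨σ c, h1 c hc, Or.inl ?_⟩
    have : σ c ∈ σ '' S.pr := ⟨c, hc, rfl⟩
    rw [h2] at this
    exact this
  | some S' =>
    obtain ⟨_, _, _, heq, -, σ, h1, h2, h3, h4, -⟩ := h
    cases heq
    exact ⟨σ c, h1 c hc, Or.inr ⟨S', rfl, h2, h3, h4 ▸ ⟨c, hc, rfl⟩⟩⟩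

theorem DeltaT.follows {P : Protocol Q M} (hWO : P.WaitOnly) {t : Q × Act M × Q}
    {SS SS' : Set (Summary Q)} {δ : Ctr P → ℤ} (h : DeltaT P t SS δ SS') :
    ∃ q b q' y, (q, Act.send b, q') ∈ P.T ∧ Follows P b SS SS' ∧ ValidCtr P y ∧
      StateOK SS' y q' ∧ y ≠ .st q ∧ δ = fun x => chi P y x - chi P (.st q) x := by
  obtain ⟨hco, hco', q, b, q', rfl, ht, h⟩ := h
  rcases h with ⟨hq', ⟨g, hg, rfl⟩, hδ⟩ | ⟨hq', S0, hS0, S0', hj, ⟨g, hg, rfl⟩, hδ⟩ |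
    ⟨hq', qa, hqa, k, hk1, hk2, hk, ⟨g, hg, rfl⟩, hδ⟩
  · refine ⟨q, b, q', .st q', ht, ?_, hq', rfl, ?_, hδ⟩
    · intro S hS c hc
      obtain ⟨c', h1, h2⟩ := follows_of_stepsTo (hg S hS) hc
      refine ⟨c', h1, h2.imp_right ?_⟩
      rintro ⟨S', h3, h4⟩
      exact ⟨S', ⟨S, hS, h3⟩, h4⟩
    · rintro h
      cases h
      exact hWO.2.2 _ _ ht
  · obtain ⟨_, _, _, heq, -, -, σ, h1, h2, h3, h4, -⟩ := hj
    cases heq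
    refine ⟨q, b, q', .sm S0.exit S0.id, ht, ?_, (hco.1 S0 hS0).2, ?_, by simp, hδ⟩
    · intro S hS c hc
      by_cases hSS : S = S0
      · subst hSS
        exact ⟨σ c, h1 c hc, Or.inr ⟨S0', Or.inl rfl, h2, h3, h4 ▸ Or.inl ⟨c, hc, rfl⟩⟩⟩
      · obtain ⟨c', h1, h2⟩ := follows_of_stepsTo (hg S hS hSS) hc
        refine ⟨c', h1, h2.imp_right ?_⟩
        rintro ⟨S', h3, h4⟩
        exact ⟨S', Or.inr ⟨S, hS, hSS, h3⟩, h4⟩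
    · exact Or.inr ⟨S0', Or.inl rfl, h2, h3, h4 ▸ Or.inr rfl⟩
  · refine ⟨q, b, q', .sm qa k, ht, ?_, ⟨hqa, hk1, hk2⟩, ?_, by simp, hδ⟩
    · intro S hS c hc
      obtain ⟨c', h1, h2⟩ := follows_of_stepsTo (hg S hS) hc
      refine ⟨c', h1, h2.imp_right ?_⟩
      rintro ⟨S', h3, h4⟩
      exact ⟨S', Or.inr ⟨S, hS, h3⟩, h4⟩
    · exact Or.inr ⟨_, Or.inl rfl, rfl, rfl, rfl⟩

/-- The process leaving counter `z` when a VASS step adds `chi y - chi z`. -/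
theorem exists_mover {P : Protocol Q M} {n : ℕ} {f : Fin n → CtrBase Q} {v' : Ctr P → ℕ}
    {y z : CtrBase Q} (hz : ValidCtr P z) (hyz : y ≠ z)
    (hv : ∀ x, (v' x : ℤ) = countOf P f x + (chi P y x - chi P z x)) :
    ∃ e, f e = z ∧ v' = countOf P (Function.update f e y) := by
  have h := hv ⟨z, hz⟩
  have h1 : chi P y ⟨z, hz⟩ = 0 := by simp [chi, hyz.symm]
  have h2 : chi P z ⟨z, hz⟩ = 1 := by simp [chi]
  rw [h1, h2] at h
  obtain ⟨e, he⟩ := exists_of_countOf_pos (P := P) (f := f) (x := ⟨z, hz⟩) (by omega)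
  refine ⟨e, he, funext fun x => ?_⟩
  have := countOf_update P f e y x
  rw [he, ← hv x] at this
  exact_mod_cast this.symm

/-- Invariant of the VASS configurations reachable from `(s_0, 0)`. -/
def ReachInv (P : Protocol Q M) (qu qf : Q) : LocW Q × (Ctr P → ℕ) → Prop
  | (.s0, v) => ∃ n, v = single P (.st P.qin) n
  | (.co SS, v) => ∃ n, ∃ (C : Fin n → Q) (f : Fin n → CtrBase Q),
      Realized P SS C f ∧ v = countOf P f ∧ (SS.Nonempty → 0 < n)
  | (.sf, v) => ∃ n, ∃ (C : Fin n → Q) (f : Fin n → CtrBase Q),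
      Realized P {Summary.mk {qf} qu 1} C f ∧ 0 < n ∧
      ∀ x, x.val ≠ .sm qu 1 → v x = countOf P f x

theorem ReachInv.step {P : Protocol Q M} {qu qf : Q} (hWO : P.WaitOnly)
    {c c' : LocW Q × (Ctr P → ℕ)} (h : ReachInv P qu qf c) (hs : (VP P qu qf).Step c c') :
    ReachInv P qu qf c' := by
  obtain ⟨l, v⟩ := c
  obtain ⟨l', v'⟩ := c'
  obtain ⟨δ, hΔ, hv⟩ := hs
  simp only at hΔ hv
  rcases hΔ with hΔ | hΔ | hΔ | hΔ | ⟨t, SS, δ', SS', hΔ, hT⟩ | ⟨SS, δ', hΔ, hE⟩ <;> cases hΔ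
  · obtain ⟨n, rfl⟩ := h
    refine ⟨n + 1, funext fun x => ?_⟩
    have := hv x
    rw [← single_succ] at this
    exact_mod_cast this
  · obtain ⟨n, rfl⟩ := h
    refine ⟨n, fun _ => P.qin, fun _ => .st P.qin,
      ⟨⟨_, fun _ => rfl, .refl⟩, fun _ => hWO.2.1, fun _ => rfl⟩, ?_, by simp⟩
    rw [countOf_const]
    funext x
    simpa using hv x
  · obtain ⟨n, C, f, hR, rfl, hn⟩ := h
    refine ⟨n, C, f, hR, hn ⟨_, rfl⟩, fun x _ => ?_⟩
    simpa using hv x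
  · obtain ⟨n, C, f, hR, hn, h⟩ := h
    refine ⟨n, C, f, hR, hn, fun x hx => ?_⟩
    have := hv x
    simp only [chi, if_neg hx] at this
    rw [← h x hx]
    simpa using this
  · obtain ⟨n, C, f, hR, rfl, hn⟩ := h
    obtain ⟨q, b, q', y, ht, hF, hy, hyq, hne, rfl⟩ := hT.follows hWO
    obtain ⟨e, he, rfl⟩ := exists_mover (P := P) (z := .st q) (mem_QA_of_send hWO ht) hne hv
    obtain ⟨C', hC'⟩ := hR.step ht hF he hy hyq
    exact ⟨n, C', _, hC', rfl, fun _ => e.pos⟩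
  · obtain ⟨n, C, f, hR, rfl, hn⟩ := h
    obtain ⟨-, q, hq, k, hk1, hk2, hk, rfl⟩ := hE
    obtain ⟨e, he, rfl⟩ := exists_mover (P := P) (z := .sm q k) ⟨hq, hk1, hk2⟩ (by simp) hv
    refine ⟨n, C, _, ⟨hR.reach, ?_, ?_⟩, rfl, hn⟩
    · intro e'
      by_cases h : e' = e
      · subst h; simpa [ValidCtr] using hq
      · simpa [Function.update_of_ne h] using hR.valid e'
    · intro e'
      by_cases h : e' = e
      · subst h
        have := hR.ok e'
        rw [he] at this
        rcases this with h | ⟨S, hS, rfl, rfl, -⟩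
        · simpa [StateOK] using h
        · exact absurd ⟨S, hS, rfl⟩ hk
      · simpa [Function.update_of_ne h] using hR.ok e'

theorem synchro_of_vass_reach {P : Protocol Q M} {qu qf : Q} (hWO : P.WaitOnly)
    (hqu : P.Uncoverable qu) (h : (VP P qu qf).Reach (LocW.s0, 0) (LocW.sf, 0)) :
    ∃ n : ℕ, 0 < n ∧ ∃ C C' : Fin n → Q,
      P.Initial C ∧ P.Reach C C' ∧ ∀ e, C' e = qf := by
  have hinv : ∀ c, (VP P qu qf).Reach (LocW.s0, 0) c → ReachInv P qu qf c := by
    intro c hc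
    induction hc with
    | refl => exact ⟨0, (single_zero P _).symm⟩
    | tail _ hs ih => exact ih.step hWO hs
  obtain ⟨n, C, f, hR, hn, hv⟩ := hinv _ h
  obtain ⟨C0, hC0, hreach⟩ := hR.reach
  refine ⟨n, hn, C0, C, hC0, hreach, fun e => ?_⟩
  have hfe : f e = .sm qu 1 := by
    by_contra hne
    have h0 := hv ⟨f e, hR.valid e⟩ hne
    have := countOf_pos (P := P) (f := f) (x := ⟨f e, hR.valid e⟩) (e := e) rfl
    simp only [Pi.zero_apply] at h0
    omega
  have := hR.ok e
  rw [hfe] at this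
  rcases this with h | ⟨S, rfl, -, -, h⟩
  · exact absurd h (ne_uncoverable_of_reach hqu hC0 hreach e)
  · exact h

/-! ### From executions to runs of the VASS -/

/-- Along the broadcasts `b i, …, b (N - 1)`, a process in waiting state `p` at time `i` can stay
in waiting states until it enters the action state `qa` at time `j`; for the exit state `qu`, it
can wait until the end and be in state `qf` then, which is recorded as the time `N + 1`. -/
inductive WaitPath (P : Protocol Q M) (b : ℕ → M) (N : ℕ) (qu qf : Q) : ℕ → Q → Q → ℕ → Prop
  | remain : qf ∈ P.QW → qu ∈ P.QA → WaitPath P b N qu qf N qf qu (N + 1)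
  | arrive {i : ℕ} {p qa : Q} : i < N → p ∈ P.QW → qa ∈ P.QA → React P (b i) p qa →
      WaitPath P b N qu qf i p qa (i + 1)
  | step {i : ℕ} {p p' qa : Q} {j : ℕ} : i < N → p ∈ P.QW → React P (b i) p p' →
      WaitPath P b N qu qf (i + 1) p' qa j → WaitPath P b N qu qf i p qa j

section WaitPath

variable {P : Protocol Q M} {b : ℕ → M} {N : ℕ} {qu qf : Q}

theorem WaitPath.lt {i j : ℕ} {p qa : Q} (h : WaitPath P b N qu qf i p qa j) : i < j := by
  induction h with
  | remain => omega
  | arrive => omega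
  | step _ _ _ _ ih => omega

theorem WaitPath.mem_QW {i j : ℕ} {p qa : Q} (h : WaitPath P b N qu qf i p qa j) :
    p ∈ P.QW := by
  cases h <;> assumption

theorem WaitPath.mem_QA {i j : ℕ} {p qa : Q} (h : WaitPath P b N qu qf i p qa j) :
    qa ∈ P.QA := by
  induction h <;> assumption

theorem WaitPath.eq_of_exit_eq (hqu : P.Uncoverable qu) {i j : ℕ} {p qa : Q}
    (h : WaitPath P b N qu qf i p qa j) (hqa : qa = qu) : j = N + 1 := by
  induction h with
  | remain => rfl
  | @arrive i p qa _ hp hqa' hr =>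
    subst hqa
    rcases hr with hr | ⟨-, rfl⟩
    · exact absurd rfl (hqu.1 _ _ _ hr).2
    · exact absurd hqa' (not_mem_QA_of_mem_QW hp)
  | step _ _ _ _ ih => exact ih hqa

theorem WaitPath.eq_of_end {j : ℕ} {p qa : Q} (h : WaitPath P b N qu qf N p qa j) :
    p = qf ∧ qa = qu := by
  cases h with
  | remain => exact ⟨rfl, rfl⟩
  | arrive h => omega
  | step h => omega

/-- `d` is the earliest time at which `qa` can be entered from `p` at time `i`. -/
def Earliest (P : Protocol Q M) (b : ℕ → M) (N : ℕ) (qu qf : Q) (i : ℕ) (p qa : Q) (d : ℕ) :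
    Prop :=
  WaitPath P b N qu qf i p qa d ∧ ∀ j, WaitPath P b N qu qf i p qa j → d ≤ j

theorem WaitPath.exists_earliest {i j : ℕ} {p qa : Q} (h : WaitPath P b N qu qf i p qa j) :
    ∃ d ≤ j, Earliest P b N qu qf i p qa d := by
  classical
  have hex : ∃ j, WaitPath P b N qu qf i p qa j := ⟨j, h⟩
  exact ⟨Nat.find hex, Nat.find_min' hex h, Nat.find_spec hex, fun j hj => Nat.find_min' hex hj⟩

theorem Earliest.unique {i d d' : ℕ} {p qa : Q} (h : Earliest P b N qu qf i p qa d)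
    (h' : Earliest P b N qu qf i p qa d') : d = d' :=
  le_antisymm (h.2 _ h'.1) (h'.2 _ h.1)

theorem Earliest.exists_react {i d : ℕ} {p qa : Q} (h : Earliest P b N qu qf i p qa d)
    (hi : i < N) : ∃ p', React P (b i) p p' ∧
      ((d = i + 1 ∧ p' = qa) ∨ (i + 1 < d ∧ Earliest P b N qu qf (i + 1) p' qa d)) := by
  obtain ⟨h, hmin⟩ := h
  cases h with
  | remain => omega
  | arrive _ _ _ hr => exact ⟨qa, hr, Or.inl ⟨rfl, rfl⟩⟩
  | @step _ _ p' _ _ _ hp hr hw =>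
    exact ⟨p', hr, Or.inr ⟨hw.lt, hw, fun j hj => hmin j (.step hi hp hr hj)⟩⟩

/-- All states of the nonempty print of `S` have earliest exit time `d` at time `i`. -/
def Deadline (P : Protocol Q M) (b : ℕ → M) (N : ℕ) (qu qf : Q) (i : ℕ) (S : Summary Q)
    (d : ℕ) : Prop :=
  S.pr.Nonempty ∧ ∀ p ∈ S.pr, Earliest P b N qu qf i p S.exit d

theorem Deadline.unique {i d d' : ℕ} {S : Summary Q} (h : Deadline P b N qu qf i S d)
    (h' : Deadline P b N qu qf i S d') : d = d' := by
  obtain ⟨p, hp⟩ := h.1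
  exact (h.2 p hp).unique (h'.2 p hp)

theorem Deadline.lt {i d : ℕ} {S : Summary Q} (h : Deadline P b N qu qf i S d) : i < d := by
  obtain ⟨p, hp⟩ := h.1
  exact (h.2 p hp).1.lt

theorem Deadline.exit_mem_QA {i d : ℕ} {S : Summary Q} (h : Deadline P b N qu qf i S d) :
    S.exit ∈ P.QA := by
  obtain ⟨p, hp⟩ := h.1
  exact (h.2 p hp).1.mem_QA

theorem Deadline.subset_QW {i d : ℕ} {S : Summary Q} (h : Deadline P b N qu qf i S d) :
    S.pr ⊆ P.QW := fun p hp => (h.2 p hp).1.mem_QW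

theorem Deadline.eq_of_exit_eq (hqu : P.Uncoverable qu) {i d : ℕ} {S : Summary Q}
    (h : Deadline P b N qu qf i S d) (hS : S.exit = qu) : d = N + 1 := by
  obtain ⟨p, hp⟩ := h.1
  exact (h.2 p hp).1.eq_of_exit_eq hqu hS

/-- The reactions of a print that realize its deadline. -/
theorem Deadline.exists_recvFun {i d : ℕ} {S : Summary Q} (h : Deadline P b N qu qf i S d)
    (hi : i < N) : ∃ σ : Q → Q, RecvFun P (b i) S.pr σ ∧
      ((d = i + 1 ∧ σ '' S.pr = {S.exit}) ∨
        (i + 1 < d ∧ Deadline P b N qu qf (i + 1) ⟨σ '' S.pr, S.exit, S.id⟩ d)) := by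
  classical
  have key : ∀ p, ∃ p', p ∈ S.pr → React P (b i) p p' ∧
      ((d = i + 1 ∧ p' = S.exit) ∨ (i + 1 < d ∧ Earliest P b N qu qf (i + 1) p' S.exit d)) := by
    intro p
    by_cases hp : p ∈ S.pr
    · obtain ⟨p', h'⟩ := (h.2 p hp).exists_react hi
      exact ⟨p', fun _ => h'⟩
    · exact ⟨p, fun h => absurd h hp⟩
  choose σ hσ using key
  refine ⟨σ, fun p hp => (hσ p hp).1, ?_⟩
  have hd := h.lt
  by_cases hdi : d = i + 1
  · refine Or.inl ⟨hdi, Set.Subset.antisymm ?_ ?_⟩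
    · rintro _ ⟨p, hp, rfl⟩
      rcases (hσ p hp).2 with h | h
      · exact h.2
      · omega
    · rintro _ rfl
      obtain ⟨p, hp⟩ := h.1
      refine ⟨p, hp, ?_⟩
      rcases (hσ p hp).2 with h | h
      · exact h.2
      · omega
  · refine Or.inr ⟨by omega, h.1.image σ, ?_⟩
    rintro _ ⟨p, hp, rfl⟩
    rcases (hσ p hp).2 with h | h
    · omega
    · exact h.2

/-- At time `i` the process with trajectory `c` is in a waiting phase that ends at time `j` in the
action state `qa`, or never ends, in which case `qa = qu` and `j = N + 1`. -/
def Future (P : Protocol Q M) (N : ℕ) (qu : Q) (c : ℕ → Q) (i : ℕ) (qa : Q) (j : ℕ) : Prop :=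
  i < j ∧ (∀ l, i ≤ l → l < j → l ≤ N → c l ∈ P.QW) ∧
    ((j ≤ N ∧ c j = qa ∧ qa ∈ P.QA) ∨ (j = N + 1 ∧ qa = qu))

theorem exists_future (P : Protocol Q M) {N : ℕ} (qu : Q) {c : ℕ → Q} {i : ℕ}
    (hc : c i ∈ P.QW) (hi : i ≤ N) : ∃ qa j, Future P N qu c i qa j := by
  classical
  by_cases hex : ∃ j, i ≤ j ∧ j ≤ N ∧ c j ∈ P.QA
  · obtain ⟨h1, h2, h3⟩ := Nat.find_spec hex
    refine ⟨c (Nat.find hex), Nat.find hex, ?_, ?_, Or.inl ⟨h2, rfl, h3⟩⟩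
    · refine lt_of_le_of_ne h1 fun h => ?_
      rw [← h] at h3
      exact h3 hc
    · intro l hl hlj hlN
      by_contra hW
      exact Nat.find_min hex hlj ⟨hl, hlN, hW⟩
  · push Not at hex
    refine ⟨qu, N + 1, by omega, fun l hl _ hlN => ?_, Or.inr ⟨rfl, rfl⟩⟩
    by_contra hW
    exact hex l hl hlN hW

theorem Future.waitPath (hqu : qu ∈ P.QA) {c : ℕ → Q} (hN : c N = qf)
    (hr : ∀ l < N, c l ∈ P.QW → React P (b l) (c l) (c (l + 1))) {i j : ℕ} {qa : Q}
    (h : Future P N qu c i qa j) (hi : i ≤ N) : WaitPath P b N qu qf i (c i) qa j := by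
  obtain ⟨m, hm⟩ : ∃ m, m = N - i := ⟨_, rfl⟩
  induction m generalizing i with
  | zero =>
    obtain rfl : i = N := by omega
    obtain ⟨h1, h2, h3 | ⟨rfl, rfl⟩⟩ := h
    · omega
    · have := h2 i le_rfl h1 le_rfl
      rw [hN] at this ⊢
      exact .remain this hqu
  | succ m ih =>
    have hiN : i < N := by omega
    obtain ⟨h1, h2, h3⟩ := h
    have hW := h2 i le_rfl h1 hi
    by_cases hj : j = i + 1
    · subst hj
      obtain ⟨-, rfl, hqa⟩ : i + 1 ≤ N ∧ c (i + 1) = qa ∧ qa ∈ P.QA := by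
        rcases h3 with h3 | h3
        · exact h3
        · omega
      exact .arrive hiN hW hqa (hr i hiN hW)
    · exact .step hiN hW (hr i hiN hW)
        (ih ⟨by omega, fun l hl => h2 l (by omega), h3⟩ hiN (by omega))

/-- The summaries of `SS` are identified both by their labels and by their deadlines. -/
structure GoodSet (P : Protocol Q M) (b : ℕ → M) (N : ℕ) (qu qf : Q) (i : ℕ)
    (SS : Set (Summary Q)) : Prop where
  id_range : ∀ S ∈ SS, 1 ≤ S.id ∧ S.id ≤ nW P + 1
  deadline : ∀ S ∈ SS, ∃ d, Deadline P b N qu qf i S d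
  deadline_inj : ∀ S1 ∈ SS, ∀ S2 ∈ SS, S1.exit = S2.exit → ∀ d, Deadline P b N qu qf i S1 d →
    Deadline P b N qu qf i S2 d → S1 = S2
  id_inj : ∀ S1 ∈ SS, ∀ S2 ∈ SS, S1.exit = S2.exit → S1.id = S2.id → S1 = S2
  id_qu : ∀ S ∈ SS, S.exit = qu → S.id = 1

theorem GoodSet.eq_of_mem_pr {i : ℕ} {SS : Set (Summary Q)} (h : GoodSet P b N qu qf i SS)
    {S1 S2 : Summary Q} (h1 : S1 ∈ SS) (h2 : S2 ∈ SS) (hex : S1.exit = S2.exit) {p : Q}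
    (hp1 : p ∈ S1.pr) (hp2 : p ∈ S2.pr) : S1 = S2 := by
  obtain ⟨d1, hd1⟩ := h.deadline S1 h1
  obtain ⟨d2, hd2⟩ := h.deadline S2 h2
  have he1 := hd1.2 p hp1
  rw [hex] at he1
  obtain rfl := he1.unique (hd2.2 p hp2)
  exact h.deadline_inj S1 h1 S2 h2 hex d1 hd1 hd2

theorem GoodSet.coherent {i : ℕ} {SS : Set (Summary Q)} (h : GoodSet P b N qu qf i SS) :
    Coherent P SS := by
  refine ⟨fun S hS => ?_, fun S1 h1 S2 h2 hne hex => ⟨?_, ?_⟩⟩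
  · obtain ⟨d, hd⟩ := h.deadline S hS
    exact ⟨hd.subset_QW, hd.exit_mem_QA, h.id_range S hS⟩
  · exact fun hid => hne (h.id_inj S1 h1 S2 h2 hex hid)
  · ext p
    simp only [Set.mem_inter_iff, Set.mem_empty_iff_false, iff_false]
    exact fun hp => hne (h.eq_of_mem_pr h1 h2 hex hp.1 hp.2)

theorem GoodSet.exists_fresh_id [Finite Q] {i : ℕ} {SS : Set (Summary Q)}
    (h : GoodSet P b N qu qf i SS) (qa : Q) :
    ∃ k, 1 ≤ k ∧ k ≤ nW P + 1 ∧ (qa, k) ∉ labs SS := by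
  classical
  by_contra hcon
  push Not at hcon
  have key : ∀ k, ∃ p, 1 ≤ k → k ≤ nW P + 1 → ∃ S ∈ SS, S.exit = qa ∧ S.id = k ∧ p ∈ S.pr := by
    intro k
    by_cases hk : 1 ≤ k ∧ k ≤ nW P + 1
    · obtain ⟨S, hS, heq⟩ := hcon k hk.1 hk.2
      obtain ⟨d, ⟨p, hp⟩, -⟩ := h.deadline S hS
      cases heq
      exact ⟨p, fun _ _ => ⟨S, hS, rfl, rfl, hp⟩⟩
    · exact ⟨qa, fun h1 h2 => absurd ⟨h1, h2⟩ hk⟩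
  choose p hp using key
  have hfin : P.QW.Finite := Set.toFinite _
  obtain ⟨k1, hk1, k2, hk2, hne, heq⟩ :=
    Finset.exists_ne_map_eq_of_card_lt_of_maps_to (s := Finset.Icc 1 (nW P + 1))
      (t := hfin.toFinset) (f := p)
      (by rw [← Set.ncard_eq_toFinset_card _ hfin]; simp [nW])
      (by
        intro k hk
        have hk := Finset.mem_Icc.1 hk
        obtain ⟨S, hS, -, -, hpS⟩ := hp k hk.1 hk.2
        obtain ⟨d, hd⟩ := h.deadline S hS
        exact hfin.mem_toFinset.2 (hd.subset_QW hpS))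
  rw [Finset.mem_Icc] at hk1 hk2
  obtain ⟨S1, hS1, he1, rfl, hp1⟩ := hp _ hk1.1 hk1.2
  obtain ⟨S2, hS2, he2, rfl, hp2⟩ := hp _ hk2.1 hk2.2
  rw [heq] at hp1
  exact hne (congrArg Summary.id (h.eq_of_mem_pr hS1 hS2 (he1.trans he2.symm) hp1 hp2))

/-- Advancing the summaries of a good set without changing labels and deadlines. -/
theorem GoodSet.advance {i i' : ℕ} {SS SS' : Set (Summary Q)} (h : GoodSet P b N qu qf i SS)
    (F : Summary Q → Summary Q)
    (hF : ∀ S' ∈ SS', ∃ S ∈ SS, S' = F S ∧ S'.exit = S.exit ∧ S'.id = S.id ∧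
      ∃ d, Deadline P b N qu qf i S d ∧ Deadline P b N qu qf i' S' d) :
    GoodSet P b N qu qf i' SS' where
  id_range S' hS' := by
    obtain ⟨S, hS, -, -, hid, -⟩ := hF S' hS'
    rw [hid]
    exact h.id_range S hS
  deadline S' hS' := by
    obtain ⟨S, -, -, -, -, d, -, hd⟩ := hF S' hS'
    exact ⟨d, hd⟩
  deadline_inj S1' h1' S2' h2' hex d hd1 hd2 := by
    obtain ⟨S1, h1, e1, x1, -, d1, hd1i, hd1'⟩ := hF S1' h1'
    obtain ⟨S2, h2, e2, x2, -, d2, hd2i, hd2'⟩ := hF S2' h2'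
    obtain rfl := hd1.unique hd1'
    obtain rfl := hd2.unique hd2'
    rw [e1, e2, h.deadline_inj S1 h1 S2 h2 (x1.symm.trans (hex.trans x2)) _ hd1i hd2i]
  id_inj S1' h1' S2' h2' hex hid := by
    obtain ⟨S1, h1, e1, x1, i1, -⟩ := hF S1' h1'
    obtain ⟨S2, h2, e2, x2, i2, -⟩ := hF S2' h2'
    rw [e1, e2, h.id_inj S1 h1 S2 h2 (x1.symm.trans (hex.trans x2)) (i1.symm.trans (hid.trans i2))]
  id_qu S' hS' hex := by
    obtain ⟨S, hS, -, x, hid, -⟩ := hF S' hS'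
    rw [hid]
    exact h.id_qu S hS (x.symm.trans hex)

theorem GoodSet.insert {i d : ℕ} {SS : Set (Summary Q)} (h : GoodSet P b N qu qf i SS)
    {S : Summary Q} (hid : 1 ≤ S.id ∧ S.id ≤ nW P + 1) (hS : Deadline P b N qu qf i S d)
    (hnew : ∀ S' ∈ SS, S'.exit = S.exit → ¬ Deadline P b N qu qf i S' d)
    (hlab : (S.exit, S.id) ∉ labs SS) (hqu : S.exit = qu → S.id = 1) :
    GoodSet P b N qu qf i (insert S SS) where
  id_range := by
    rintro S' (rfl | hS')
    · exact hid
    · exact h.id_range S' hS'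
  deadline := by
    rintro S' (rfl | hS')
    · exact ⟨d, hS⟩
    · exact h.deadline S' hS'
  deadline_inj := by
    rintro S1 (rfl | h1) S2 (rfl | h2) hex d' hd1 hd2
    · rfl
    · exact absurd (hd1.unique hS ▸ hd2) (hnew S2 h2 hex.symm)
    · exact absurd (hd2.unique hS ▸ hd1) (hnew S1 h1 hex)
    · exact h.deadline_inj S1 h1 S2 h2 hex d' hd1 hd2
  id_inj := by
    rintro S1 (rfl | h1) S2 (rfl | h2) hex hid
    · rfl
    · exact absurd ⟨S2, h2, by simp [hex, hid]⟩ hlab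
    · exact absurd ⟨S1, h1, by simp [hex, hid]⟩ hlab
    · exact h.id_inj S1 h1 S2 h2 hex hid
  id_qu := by
    rintro S' (rfl | hS') hex
    · exact hqu hex
    · exact h.id_qu S' hS' hex

/-- The counter `x` is admissible at time `i` for a process with trajectory `c`. -/
def CounterOK (P : Protocol Q M) (b : ℕ → M) (N : ℕ) (qu qf : Q) (i : ℕ)
    (SS : Set (Summary Q)) (c : ℕ → Q) (x : CtrBase Q) : Prop :=
  (c i ∈ P.QA ∧ x = .st (c i)) ∨
  ∃ qa j, Future P N qu c i qa j ∧ ((qa ≠ qu ∧ x = .st qa) ∨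
    ∃ S ∈ SS, S.exit = qa ∧ x = .sm qa S.id ∧ ∃ d ≤ j, Deadline P b N qu qf i S d)

theorem CounterOK.valid {i : ℕ} {SS : Set (Summary Q)} (hSS : GoodSet P b N qu qf i SS)
    {c : ℕ → Q} {x : CtrBase Q} (h : CounterOK P b N qu qf i SS c x) : ValidCtr P x := by
  rcases h with ⟨h, rfl⟩ | ⟨qa, j, hfut, ⟨hne, rfl⟩ | ⟨S, hS, rfl, rfl, d, -, hd⟩⟩
  · exact h
  · rcases hfut.2.2 with h | h
    · exact h.2.2
    · exact absurd h.2 hne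
  · exact ⟨hd.exit_mem_QA, hSS.id_range S hS⟩

open Classical in
/-- A process of a finished summary is moved to the counter of its exit state. -/
noncomputable def settle (SS : Set (Summary Q)) : CtrBase Q → CtrBase Q
  | .st q => .st q
  | .sm q k => if (q, k) ∈ labs SS then .sm q k else .st q

theorem reach_settle_one {SS : Set (Summary Q)} (hSS : Coherent P SS) {n : ℕ}
    (f : Fin n → CtrBase Q) (e : Fin n) (he : ValidCtr P (f e)) :
    (VP P qu qf).Reach (.co SS, countOf P f)
      (.co SS, countOf P (Function.update f e (settle SS (f e)))) := by
  cases hfe : f e with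
  | st q =>
    rw [show settle SS (.st q) = f e from hfe.symm, Function.update_eq_self]
    exact .refl
  | sm q k =>
    by_cases hlab : (q, k) ∈ labs SS
    · rw [show settle SS (.sm q k) = f e by simp [settle, hlab, hfe], Function.update_eq_self]
      exact .refl
    · rw [show settle SS (.sm q k) = .st q by simp [settle, hlab]]
      rw [hfe] at he
      refine .single ⟨_, Or.inr <| Or.inr <| Or.inr <| Or.inr <| Or.inr ⟨SS, _, rfl, hSS, q, he.1,
        k, he.2.1, he.2.2, hlab, rfl⟩, fun x => ?_⟩
      rw [countOf_update, hfe]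

theorem reach_settle {SS : Set (Summary Q)} (hSS : Coherent P SS) {n : ℕ}
    (f : Fin n → CtrBase Q) (hf : ∀ e, ValidCtr P (f e)) :
    (VP P qu qf).Reach (.co SS, countOf P f) (.co SS, countOf P (fun e => settle SS (f e))) := by
  classical
  suffices h : ∀ A : Finset (Fin n), (VP P qu qf).Reach (.co SS, countOf P f)
      (.co SS, countOf P (fun e => if e ∈ A then settle SS (f e) else f e)) by
    simpa using h Finset.univ
  intro A
  induction A using Finset.induction_on with
  | empty =>
    simp only [Finset.notMem_empty, if_false]
    exact .refl
  | insert a A ha ih =>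
    refine ih.trans ?_
    have h := reach_settle_one (qu := qu) (qf := qf) hSS
      (fun e => if e ∈ A then settle SS (f e) else f e) a (by simpa [ha] using hf a)
    rw [show Function.update (fun e => if e ∈ A then settle SS (f e) else f e) a
        (settle SS (if a ∈ A then settle SS (f a) else f a))
        = fun e => if e ∈ insert a A then settle SS (f e) else f e from ?_] at h
    · exact h
    · funext e
      by_cases he : e = a
      · subst he; simp [ha]
      · simp [he]

theorem CounterOK.settle_eq {i : ℕ} {SS : Set (Summary Q)} {c : ℕ → Q} {x : CtrBase Q}
    (h : CounterOK P b N qu qf i SS c x) : settle SS x = x := by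
  rcases h with ⟨-, rfl⟩ | ⟨qa, j, -, ⟨-, rfl⟩ | ⟨S, hS, rfl, rfl, -⟩⟩
  · rfl
  · rfl
  · exact if_pos ⟨S, hS, rfl⟩

theorem CounterOK.advance (hqu : P.Uncoverable qu) {i : ℕ} (hi : i < N)
    {SS SS' : Set (Summary Q)}
    (hlive : ∀ S ∈ SS, ∀ d, Deadline P b N qu qf i S d → i + 1 < d →
      ∃ S' ∈ SS', S'.exit = S.exit ∧ S'.id = S.id ∧ Deadline P b N qu qf (i + 1) S' d)
    (hdone : ∀ S ∈ SS, Deadline P b N qu qf i S (i + 1) → (S.exit, S.id) ∉ labs SS')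
    {c : ℕ → Q} (hc : React P (b i) (c i) (c (i + 1))) {x : CtrBase Q}
    (h : CounterOK P b N qu qf i SS c x) :
    CounterOK P b N qu qf (i + 1) SS' c (settle SS' x) := by
  rcases h with ⟨h, rfl⟩ | ⟨qa, j, ⟨hij, hW, hend⟩, h⟩
  · have heq := hc.eq_of_mem_QA h
    exact Or.inl ⟨heq.symm ▸ h, by rw [heq]; rfl⟩
  have early : qa ≠ qu → CounterOK P b N qu qf (i + 1) SS' c (.st qa) := by
    intro hne
    by_cases hj : j = i + 1
    · subst hj
      rcases hend with ⟨-, rfl, hqa⟩ | ⟨-, rfl⟩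
      · exact Or.inl ⟨hqa, rfl⟩
      · exact absurd rfl hne
    · exact Or.inr ⟨qa, j, ⟨by omega, fun l hl => hW l (by omega), hend⟩, Or.inl ⟨hne, rfl⟩⟩
  rcases h with ⟨hne, rfl⟩ | ⟨S, hS, rfl, rfl, d, hdj, hd⟩
  · exact early hne
  · have hid := hd.lt
    by_cases hdi : d = i + 1
    · subst hdi
      rw [show settle SS' (.sm S.exit S.id) = .st S.exit from if_neg (hdone S hS hd)]
      refine early fun hex => ?_
      have := hd.eq_of_exit_eq hqu hex
      omega
    · obtain ⟨S', hS', hex, hids, hd'⟩ := hlive S hS d hd (by omega)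
      rw [show settle SS' (.sm S.exit S.id) = .sm S.exit S.id from
        if_pos ⟨S', hS', by simp [hex, hids]⟩]
      exact Or.inr ⟨S.exit, j, ⟨by omega, fun l hl => hW l (by omega), hend⟩,
        Or.inr ⟨S', hS', hex, by rw [hids], d, hdj, hd'⟩⟩

/-- A broadcast step together with a matching transition of the VASS. -/
theorem exists_vass_reach_of_deltaT (hqu : P.Uncoverable qu) {n i : ℕ} (hi : i < N)
    {C : ℕ → Fin n → Q} {SS SS' : Set (Summary Q)} {f : Fin n → CtrBase Q} {e0 : Fin n}
    {t : Q × Act M × Q} {y : CtrBase Q}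
    (hgood : GoodSet P b N qu qf i SS) (hgood' : GoodSet P b N qu qf (i + 1) SS')
    (hf : ∀ e, CounterOK P b N qu qf i SS (fun l => C l e) (f e))
    (hreact : ∀ e ≠ e0, React P (b i) (C i e) (C (i + 1) e))
    (hlive : ∀ S ∈ SS, ∀ d, Deadline P b N qu qf i S d → i + 1 < d →
      ∃ S' ∈ SS', S'.exit = S.exit ∧ S'.id = S.id ∧ Deadline P b N qu qf (i + 1) S' d)
    (hdone : ∀ S ∈ SS, Deadline P b N qu qf i S (i + 1) → (S.exit, S.id) ∉ labs SS')
    (hy : CounterOK P b N qu qf (i + 1) SS' (fun l => C l e0) y)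
    (hT : DeltaT P t SS (fun x => chi P y x - chi P (f e0) x) SS') :
    ∃ SS' f', GoodSet P b N qu qf (i + 1) SS' ∧
      (∀ e, CounterOK P b N qu qf (i + 1) SS' (fun l => C l e) (f' e)) ∧
      (VP P qu qf).Reach (.co SS, countOf P f) (.co SS', countOf P f') := by
  refine ⟨SS', fun e => settle SS' (Function.update f e0 y e), hgood', fun e => ?_, ?_⟩
  · change CounterOK P b N qu qf (i + 1) SS' _ (settle SS' (Function.update f e0 y e))
    by_cases he : e = e0
    · subst he
      rw [Function.update_self, hy.settle_eq]
      exact hy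
    · rw [Function.update_of_ne he]
      exact (hf e).advance hqu hi hlive hdone (hreact e he)
  · have hs : (VP P qu qf).Step (.co SS, countOf P f)
        (.co SS', countOf P (Function.update f e0 y)) :=
      ⟨_, Or.inr <| Or.inr <| Or.inr <| Or.inr <| Or.inl ⟨t, SS, _, SS', rfl, hT⟩,
        fun x => countOf_update P f e0 y x⟩
    refine (reach_settle hgood'.coherent _ fun e => ?_).head hs
    by_cases he : e = e0
    · subst he
      rw [Function.update_self]
      exact hy.valid hgood'
    · rw [Function.update_of_ne he]
      exact (hf e).valid hgood

theorem exists_vass_reach_of_step [Finite Q] (hWO : P.WaitOnly) (hqu : P.Uncoverable qu)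
    {n i : ℕ} (hi : i < N) {C : ℕ → Fin n → Q} (hCN : ∀ e, C N e = qf) {e0 : Fin n}
    (ht : (C i e0, Act.send (b i), C (i + 1) e0) ∈ P.T)
    (hreact : ∀ e ≠ e0, React P (b i) (C i e) (C (i + 1) e))
    (hwait : ∀ e, ∀ l < N, C l e ∈ P.QW → React P (b l) (C l e) (C (l + 1) e))
    {SS : Set (Summary Q)} {f : Fin n → CtrBase Q} (hgood : GoodSet P b N qu qf i SS)
    (hf : ∀ e, CounterOK P b N qu qf i SS (fun l => C l e) (f e)) :
    ∃ SS' f', GoodSet P b N qu qf (i + 1) SS' ∧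
      (∀ e, CounterOK P b N qu qf (i + 1) SS' (fun l => C l e) (f' e)) ∧
      (VP P qu qf).Reach (.co SS, countOf P f) (.co SS', countOf P f') := by
  classical
  have hquA := uncoverable_mem_QA hqu
  have hq := mem_QA_of_send hWO ht
  have hfe0 : f e0 = .st (C i e0) := by
    rcases hf e0 with h | ⟨_, _, h, -⟩
    · exact h.2
    · exact absurd hq (not_mem_QA_of_mem_QW (h.2.1 i le_rfl h.1 hi.le))
  have key : ∀ S, ∃ d, ∃ σ : Q → Q, S ∈ SS → Deadline P b N qu qf i S d ∧
      RecvFun P (b i) S.pr σ ∧ ((d = i + 1 ∧ σ '' S.pr = {S.exit}) ∨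
        (i + 1 < d ∧ Deadline P b N qu qf (i + 1) ⟨σ '' S.pr, S.exit, S.id⟩ d)) := by
    intro S
    by_cases hS : S ∈ SS
    · obtain ⟨d, hd⟩ := hgood.deadline S hS
      obtain ⟨σ, h⟩ := hd.exists_recvFun hi
      exact ⟨d, σ, fun _ => ⟨hd, h⟩⟩
    · exact ⟨0, id, fun h => absurd h hS⟩
  choose dl σ hσ using key
  set t : Q × Act M × Q := (C i e0, Act.send (b i), C (i + 1) e0)
  let F : Summary Q → Summary Q := fun S => ⟨σ S '' S.pr, S.exit, S.id⟩
  let g : Summary Q → Option (Summary Q) := fun S => if dl S = i + 1 then none else some (F S)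
  have hg : ∀ S ∈ SS, stepsTo P t S (g S) := by
    intro S hS
    obtain ⟨hd, hr, h⟩ := hσ S hS
    by_cases hdi : dl S = i + 1
    · simp only [g, if_pos hdi]
      rcases h with h | h
      · exact ⟨_, _, _, rfl, ht, σ S, hr, h.2⟩
      · omega
    · simp only [g, if_neg hdi]
      rcases h with h | h
      · exact absurd h.1 hdi
      · exact ⟨_, _, _, rfl, ht, σ S, hr, rfl, rfl, rfl, h.2.subset_QW⟩
  have hlive : ∀ S ∈ SS, i + 1 < dl S →
      g S = some (F S) ∧ Deadline P b N qu qf (i + 1) (F S) (dl S) := by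
    intro S hS hlt
    refine ⟨if_neg (by omega), ?_⟩
    rcases (hσ S hS).2.2 with h | h
    · omega
    · exact h.2
  have hgsome : ∀ S ∈ SS, ∀ S', g S = some S' → S' = F S ∧ i + 1 < dl S := by
    intro S hS S' hSS'
    have hd := (hσ S hS).1.lt
    by_cases hdi : dl S = i + 1
    · simp [g, hdi] at hSS'
    · simp only [g, if_neg hdi, Option.some.injEq] at hSS'
      exact ⟨hSS'.symm, by omega⟩
  have hdl : ∀ S ∈ SS, ∀ d, Deadline P b N qu qf i S d → dl S = d :=
    fun S hS d hd => (hσ S hS).1.unique hd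
  set SS1 : Set (Summary Q) := {S' | ∃ S ∈ SS, g S = some S'}
  have hgood1 : GoodSet P b N qu qf (i + 1) SS1 := by
    refine hgood.advance F ?_
    rintro S' ⟨S, hS, hgS⟩
    obtain ⟨rfl, hlt⟩ := hgsome S hS S' hgS
    exact ⟨S, hS, rfl, rfl, rfl, dl S, (hσ S hS).1, (hlive S hS hlt).2⟩
  have hlive1 : ∀ S ∈ SS, ∀ d, Deadline P b N qu qf i S d → i + 1 < d →
      ∃ S' ∈ SS1, S'.exit = S.exit ∧ S'.id = S.id ∧ Deadline P b N qu qf (i + 1) S' d := by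
    intro S hS d hd hlt
    obtain rfl := hdl S hS d hd
    obtain ⟨h1, h2⟩ := hlive S hS hlt
    exact ⟨F S, ⟨S, hS, h1⟩, rfl, rfl, h2⟩
  have hdone1 : ∀ S ∈ SS, Deadline P b N qu qf i S (i + 1) → (S.exit, S.id) ∉ labs SS1 := by
    rintro S hS hd ⟨_, ⟨S2, hS2, hgS2⟩, heq⟩
    obtain ⟨rfl, hlt⟩ := hgsome S2 hS2 _ hgS2
    simp only [Prod.mk.injEq] at heq
    obtain rfl := hgood.id_inj S2 hS2 S hS heq.1 heq.2
    have := hdl S2 hS _ hd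
    omega
  by_cases hq' : C (i + 1) e0 ∈ P.QW
  swap
  · refine exists_vass_reach_of_deltaT (t := t) (y := .st (C (i + 1) e0)) hqu hi hgood hgood1 hf
      hreact hlive1 hdone1 (Or.inl ⟨hq', rfl⟩) ⟨hgood.coherent, hgood1.coherent, _, _, _, rfl, ht,
        Or.inl ⟨hq', ⟨g, hg, rfl⟩, ?_⟩⟩
    rw [hfe0]
  obtain ⟨qa, j, hfut⟩ := exists_future P qu (c := fun l => C l e0) hq' hi
  have hpath := hfut.waitPath hquA (hCN e0) (hwait e0) hi
  obtain ⟨d, hdj, hd⟩ := hpath.exists_earliest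
  have hid := hd.1.lt
  by_cases hjoin : ∃ S0 ∈ SS, S0.exit = qa ∧ Deadline P b N qu qf i S0 d
  · obtain ⟨S0, hS0, rfl, hd0⟩ := hjoin
    obtain rfl := hdl S0 hS0 d hd0
    let S0' : Summary Q := ⟨σ S0 '' S0.pr ∪ {C (i + 1) e0}, S0.exit, S0.id⟩
    have hd0' : Deadline P b N qu qf (i + 1) S0' (dl S0) := by
      refine ⟨⟨_, Or.inr rfl⟩, ?_⟩
      rintro p (hp | rfl)
      · exact (hlive S0 hS0 hid).2.2 p hp
      · exact hd
    have hgood2 : GoodSet P b N qu qf (i + 1)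
        (insert S0' {S' | ∃ S ∈ SS, S ≠ S0 ∧ g S = some S'}) := by
      refine hgood.advance (Function.update F S0 S0') ?_
      rintro S' (rfl | ⟨S, hS, hne, hgS⟩)
      · exact ⟨S0, hS0, by simp, rfl, rfl, dl S0, hd0, hd0'⟩
      · obtain ⟨rfl, hlt⟩ := hgsome S hS S' hgS
        exact ⟨S, hS, by simp [hne], rfl, rfl, dl S, (hσ S hS).1, (hlive S hS hlt).2⟩
    refine exists_vass_reach_of_deltaT (t := t) (y := .sm S0.exit S0.id) hqu hi hgood hgood2 hf
      hreact ?_ ?_ (Or.inr ⟨_, j, hfut, Or.inr ⟨S0', Or.inl rfl, rfl, rfl, _, hdj, hd0'⟩⟩)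
      ⟨hgood.coherent, hgood2.coherent, _, _, _, rfl, ht, Or.inr <| Or.inl ⟨hq', S0, hS0, S0',
        ⟨_, _, _, rfl, ht, hq', σ S0, (hσ S0 hS0).2.1, rfl, rfl, rfl, hd0'.subset_QW⟩,
        ⟨g, fun S hS _ => hg S hS, rfl⟩, ?_⟩⟩
    · intro S hS d' hdS hlt
      by_cases hne : S = S0
      · subst hne
        obtain rfl := hdl S hS _ hdS
        exact ⟨S0', Or.inl rfl, rfl, rfl, hd0'⟩
      · obtain rfl := hdl S hS _ hdS
        obtain ⟨h1, h2⟩ := hlive S hS hlt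
        exact ⟨F S, Or.inr ⟨S, hS, hne, h1⟩, rfl, rfl, h2⟩
    · rintro S hS hdS ⟨S', (rfl | ⟨S2, hS2, hne, hgS2⟩), heq⟩
      · simp only [S0', Prod.mk.injEq] at heq
        obtain rfl := hgood.id_inj S0 hS0 S hS heq.1 heq.2
        have := hdl S0 hS _ hdS
        omega
      · exact hdone1 S hS hdS ⟨S', ⟨S2, hS2, hgS2⟩, heq⟩
    · rw [hfe0]
  · have hfresh : ∃ k, 1 ≤ k ∧ k ≤ nW P + 1 ∧ (qa, k) ∉ labs SS ∧ (qa = qu → k = 1) := by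
      by_cases hqa : qa = qu
      · refine ⟨1, le_rfl, by omega, ?_, fun _ => rfl⟩
        rintro ⟨S, hS, heq⟩
        simp only [Prod.mk.injEq] at heq
        have h1 := (hσ S hS).1
        refine hjoin ⟨S, hS, heq.1, ?_⟩
        rw [hd.1.eq_of_exit_eq hqu hqa, ← h1.eq_of_exit_eq hqu (heq.1.trans hqa)]
        exact h1
      · obtain ⟨k, h1, h2, h3⟩ := hgood.exists_fresh_id qa
        exact ⟨k, h1, h2, h3, fun h => absurd h hqa⟩
    obtain ⟨k, hk1, hk2, hk, hkqu⟩ := hfresh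
    let Sn : Summary Q := ⟨{C (i + 1) e0}, qa, k⟩
    have hdn : Deadline P b N qu qf (i + 1) Sn d := by
      refine ⟨⟨_, rfl⟩, ?_⟩
      rintro p rfl
      exact hd
    have hlab1 : (qa, k) ∉ labs SS1 := by
      rintro ⟨_, ⟨S, hS, hgS⟩, heq⟩
      obtain ⟨rfl, -⟩ := hgsome S hS _ hgS
      exact hk ⟨S, hS, heq⟩
    have hgood2 : GoodSet P b N qu qf (i + 1) (insert Sn SS1) := by
      refine hgood1.insert ⟨hk1, hk2⟩ hdn ?_ hlab1 hkqu
      rintro _ ⟨S, hS, hgS⟩ hex hdS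
      obtain ⟨rfl, hlt⟩ := hgsome S hS _ hgS
      refine hjoin ⟨S, hS, hex, ?_⟩
      rw [hdS.unique (hlive S hS hlt).2]
      exact (hσ S hS).1
    refine exists_vass_reach_of_deltaT (t := t) (y := .sm qa k) hqu hi hgood hgood2 hf hreact
      ?_ ?_ (Or.inr ⟨_, j, hfut, Or.inr ⟨Sn, Or.inl rfl, rfl, rfl, _, hdj, hdn⟩⟩)
      ⟨hgood.coherent, hgood2.coherent, _, _, _, rfl, ht, Or.inr <| Or.inr ⟨hq', qa, hd.1.mem_QA,
        k, hk1, hk2, hk, ⟨g, hg, rfl⟩, ?_⟩⟩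
    · intro S hS d' hdS hlt
      obtain ⟨S', hS', h⟩ := hlive1 S hS d' hdS hlt
      exact ⟨S', Or.inr hS', h⟩
    · rintro S hS hdS ⟨S', (rfl | hS'), heq⟩
      · exact hk ⟨S, hS, heq.symm⟩
      · exact hdone1 S hS hdS ⟨S', hS', heq⟩
    · rw [hfe0]

end WaitPath

theorem exists_seq_of_reach {P : Protocol Q M} {n : ℕ} {C C' : Fin n → Q} (h : P.Reach C C') :
    ∃ (N : ℕ) (D : ℕ → Fin n → Q), D 0 = C ∧ D N = C' ∧ ∀ i < N, P.StepAny (D i) (D (i + 1)) := by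
  induction h using Relation.ReflTransGen.head_induction_on with
  | refl => exact ⟨0, fun _ => C', rfl, rfl, fun _ h => absurd h (Nat.not_lt_zero _)⟩
  | @head C C1 hs _ ih =>
    obtain ⟨N, D, h0, hN, hD⟩ := ih
    refine ⟨N + 1, fun | 0 => C | i + 1 => D i, rfl, hN, ?_⟩
    rintro (_ | i) hi
    · simpa [h0] using hs
    · exact hD i (by omega)

theorem reach_load (P : Protocol Q M) (qu qf : Q) (m : ℕ) :
    (VP P qu qf).Reach (.s0, 0) (.s0, single P (.st P.qin) m) := by
  induction m with
  | zero =>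
    rw [single_zero]
    exact .refl
  | succ m ih => exact ih.tail ⟨_, Or.inl rfl, fun x => single_succ P _ m x⟩

theorem reach_unload (P : Protocol Q M) (qu qf : Q) (m : ℕ) :
    (VP P qu qf).Reach (.sf, single P (.sm qu 1) m) (.sf, 0) := by
  induction m with
  | zero =>
    rw [single_zero]
    exact .refl
  | succ m ih =>
    refine ih.head ⟨_, Or.inr <| Or.inr <| Or.inr <| Or.inl rfl, fun x => ?_⟩
    simp only [single_succ]
    ring

theorem vass_reach_of_synchro [Finite Q] {P : Protocol Q M} {qu qf : Q} (hWO : P.WaitOnly)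
    (hqu : P.Uncoverable qu) (hqf : qf ∈ P.QW) {n : ℕ} (hn : 0 < n) {C C' : Fin n → Q}
    (hC : P.Initial C) (hR : P.Reach C C') (hC' : ∀ e, C' e = qf) :
    (VP P qu qf).Reach (LocW.s0, 0) (LocW.sf, 0) := by
  obtain ⟨N, D, rfl, rfl, hD⟩ := exists_seq_of_reach hR
  have hN : 0 < N := by
    rcases Nat.eq_zero_or_pos N with rfl | h
    · have h := hC ⟨0, hn⟩
      rw [hC' ⟨0, hn⟩] at h
      exact absurd (h ▸ hqf) hWO.2.1
    · exact h
  have hstep : ∀ i < N, ∃ a e0, (D i e0, Act.send a, D (i + 1) e0) ∈ P.T ∧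
      ∀ e ≠ e0, React P a (D i e) (D (i + 1) e) := by
    intro i hi
    obtain ⟨e0, _, q, a, q', rfl, ht, rfl, rfl, h⟩ := hD i hi
    exact ⟨a, e0, ht, h⟩
  have : Nonempty M := (hstep 0 hN).nonempty
  have : Nonempty (Fin n) := ⟨⟨0, hn⟩⟩
  choose! b m hm hreact using hstep
  have hwait : ∀ e, ∀ l < N, D l e ∈ P.QW → React P (b l) (D l e) (D (l + 1) e) := by
    intro e l hl hW
    refine hreact l hl e ?_
    rintro rfl
    exact not_mem_QA_of_mem_QW hW (mem_QA_of_send hWO (hm l hl))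
  have main : ∀ i ≤ N, ∃ SS f, GoodSet P b N qu qf i SS ∧
      (∀ e, CounterOK P b N qu qf i SS (fun l => D l e) (f e)) ∧
      (VP P qu qf).Reach (.s0, 0) (.co SS, countOf P f) := by
    intro i
    induction i with
    | zero =>
      refine fun _ => ⟨∅, fun _ => .st P.qin, ⟨by simp, by simp, by simp, by simp, by simp⟩,
        fun e => Or.inl ?_, ?_⟩
      · simp only [hC e]
        exact ⟨hWO.2.1, trivial⟩
      · rw [countOf_const]
        exact (reach_load P qu qf n).tail ⟨0, Or.inr <| Or.inl rfl, fun x => by simp⟩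
    | succ i ih =>
      intro hi
      obtain ⟨SS, f, hgood, hf, hreach⟩ := ih (by omega)
      obtain ⟨SS', f', hgood', hf', hreach'⟩ := exists_vass_reach_of_step hWO hqu hi hC'
        (hm i hi) (hreact i hi) hwait hgood hf
      exact ⟨SS', f', hgood', hf', hreach.trans hreach'⟩
  obtain ⟨SS, f, hgood, hf, hreach⟩ := main N le_rfl
  have hSS : ∀ S ∈ SS, S = ⟨{qf}, qu, 1⟩ := by
    intro S hS
    obtain ⟨d, ⟨p, hp⟩, hd⟩ := hgood.deadline S hS
    have hid := hgood.id_qu S hS (hd p hp).1.eq_of_end.2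
    have hpr : S.pr = {qf} := Set.eq_singleton_iff_nonempty_unique_mem.2
      ⟨⟨p, hp⟩, fun r hr => (hd r hr).1.eq_of_end.1⟩
    obtain ⟨pr, ex, k⟩ := S
    obtain rfl : ex = qu := (hd p hp).1.eq_of_end.2
    obtain rfl : k = 1 := hid
    obtain rfl : pr = {qf} := hpr
    rfl
  have hfe : ∀ e, f e = .sm qu 1 ∧ SS.Nonempty := by
    intro e
    rcases hf e with ⟨h, -⟩ | ⟨qa, j, hfut, h⟩
    · simp only [hC' e] at h
      exact absurd h (not_mem_QA_of_mem_QW hqf)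
    · obtain ⟨-, rfl⟩ : j = N + 1 ∧ qa = qu := by
        rcases hfut.2.2 with h | h
        · have := hfut.1
          omega
        · exact h
      rcases h with ⟨h, -⟩ | ⟨S, hS, hex, h, -⟩
      · exact absurd rfl h
      · rw [h, hgood.id_qu S hS hex]
        exact ⟨rfl, S, hS⟩
  obtain rfl : SS = {⟨{qf}, qu, 1⟩} :=
    Set.eq_singleton_iff_nonempty_unique_mem.2 ⟨(hfe ⟨0, hn⟩).2, hSS⟩
  obtain rfl : f = fun _ => .sm qu 1 := funext fun e => (hfe e).1
  rw [countOf_const] at hreach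
  exact (hreach.tail ⟨0, Or.inr <| Or.inr <| Or.inl rfl, fun x => by simp⟩).trans
    (reach_unload P qu qf n)

end BP

open BP in
/-- **Correctness of the VASS construction (decidability of Synchro).** For a Wait-Only
protocol `P` with final waiting state `q_f`, synchronization in `q_f` is possible iff
`(s_0, 0) ⇝* (s_f, 0)` in the VASS `V_P`; hence the synchronization problem reduces to
VASS reachability and is decidable. -/
theorem synchro_iff_vass_reach {Q M : Type} [Fintype Q] [Fintype M]
    (P : Protocol Q M) (qu qf : Q)
    (hWO : P.WaitOnly) (hqu : P.Uncoverable qu) (hqf : qf ∈ P.QW) :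
    (∃ (n : ℕ), 0 < n ∧ ∃ C C' : Fin n → Q,
       P.Initial C ∧ P.Reach C C' ∧ ∀ e, C' e = qf) ↔
    (VP P qu qf).Reach (LocW.s0, 0) (LocW.sf, 0) := by
  constructor
  · rintro ⟨n, hn, C, C', hC, hR, hC'⟩
    exact vass_reach_of_synchro hWO hqu hqf hn hC hR hC'
  · exact synchro_of_vass_reach hWO hqu
end

section
/- Let V = (Loc, ℓ_0, X, Δ) be a VASS in which every transition changes exactly one counter by exactly ±1, let ℓ_f ∈ Loc, and let P_V be the Wait-Only protocol built from V. Then there exist an initial configuration C_0 of P_V and a configuration C_f such that C_0 →* C_f and C_f(e) = q_f for all e ∈ [1, ||C_f||], if and only if (ℓ_0, 0) ⇝* (ℓ_f, 0) in V. -/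
set_option maxHeartbeats 1000000

/-- Every transition changes exactly one counter, by exactly `±1`. -/
def UnitVASS {L X : Type} (V : VASS L X) : Prop :=
  ∀ d ∈ V.Δ, ∃ x : X, (d.2.1 x = 1 ∨ d.2.1 x = -1) ∧ ∀ y, y ≠ x → d.2.1 y = 0

/-- States of the protocol built from a VASS. -/
inductive PVSt (L X : Type) where
  | qin : PVSt L X
  | q1 : PVSt L X
  | zro : PVSt L X
  | zend : PVSt L X
  | lf' : PVSt L X
  | qf : PVSt L X
  | err : PVSt L X
  | err' : PVSt L X
  | unit : X → PVSt L X
  | loc : L → PVSt L X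
  | frown : PVSt L X

/-- Messages of the protocol built from a VASS. -/
inductive PVMsg (X : Type) where
  | start : PVMsg X
  | dollar : PVMsg X
  | fin : PVMsg X
  | verif : PVMsg X
  | inc : X → PVMsg X
  | dec : X → PVMsg X

/-- The Wait-Only protocol `P_V` built from the VASS `V` (Ackermann-hardness reduction:
thick edges included, no dashed edge). -/
def PV {L X : Type} (V : VASS L X) (lf : L) : Protocol (PVSt L X) (PVMsg X) where
  qin := .qin
  T := {tr |
    tr = (.qin, Act.send .start, .loc V.init) ∨
    tr = (.qin, Act.send .dollar, .q1) ∨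
    tr = (.q1, Act.recv .start, .zro) ∨
    (∃ x, tr = (.zro, Act.send (.inc x), .unit x)) ∨
    (∃ x, tr = (.unit x, Act.send (.dec x), .zro)) ∨
    tr = (.zro, Act.send .fin, .zend) ∨
    tr = (.loc lf, Act.recv .fin, .lf') ∨
    tr = (.lf', Act.send .verif, .qf) ∨
    tr = (.zend, Act.recv .verif, .qf) ∨
    tr = (.qf, Act.recv .verif, .err) ∨
    (∃ x, tr = (.zend, Act.recv (.inc x), .err')) ∨
    (∃ x, tr = (.zend, Act.recv (.dec x), .err')) ∨
    (∃ ℓ ℓ' x δ, (ℓ, δ, ℓ') ∈ V.Δ ∧ δ x = 1 ∧ tr = (.loc ℓ, Act.recv (.inc x), .loc ℓ')) ∨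
    (∃ ℓ ℓ' x δ, (ℓ, δ, ℓ') ∈ V.Δ ∧ δ x = -1 ∧ tr = (.loc ℓ, Act.recv (.dec x), .loc ℓ')) ∨
    (∃ ℓ x, tr = (.loc ℓ, Act.recv (.inc x), .frown)) ∨
    (∃ ℓ x, tr = (.loc ℓ, Act.recv (.dec x), .frown))}

namespace PV

variable {L X : Type}

/-- How a state may change when another participant broadcasts `a`. -/
def Responds (V : VASS L X) (lf : L) (a : PVMsg X) (p p' : PVSt L X) : Prop :=
  (p, Act.recv a, p') ∈ (PV V lf).T ∨ (a ∉ (PV V lf).R p ∧ p' = p)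

theorem responds_start {V : VASS L X} {lf : L} {p p' : PVSt L X} :
    Responds V lf .start p p' ↔ (p = .q1 ∧ p' = .zro) ∨ (p ≠ .q1 ∧ p' = p) := by
  cases p <;> simp [Responds, PV, Protocol.R]

theorem responds_dollar {V : VASS L X} {lf : L} {p p' : PVSt L X} :
    Responds V lf .dollar p p' ↔ p' = p := by
  cases p <;> simp [Responds, PV, Protocol.R]

theorem responds_fin {V : VASS L X} {lf : L} {p p' : PVSt L X} :
    Responds V lf .fin p p' ↔ (p = .loc lf ∧ p' = .lf') ∨ (p ≠ .loc lf ∧ p' = p) := by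
  cases p <;> simp [Responds, PV, Protocol.R]

theorem responds_verif {V : VASS L X} {lf : L} {p p' : PVSt L X} :
    Responds V lf .verif p p' ↔ (p = .zend ∧ p' = .qf) ∨ (p = .qf ∧ p' = .err) ∨
      (p ≠ .zend ∧ p ≠ .qf ∧ p' = p) := by
  cases p <;> simp [Responds, PV, Protocol.R]

theorem responds_inc {V : VASS L X} {lf : L} {x : X} {p p' : PVSt L X} :
    Responds V lf (.inc x) p p' ↔ (p = .zend ∧ p' = .err') ∨
      (∃ ℓ, p = .loc ℓ ∧ (p' = .frown ∨ ∃ ℓ' δ, (ℓ, δ, ℓ') ∈ V.Δ ∧ δ x = 1 ∧ p' = .loc ℓ')) ∨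
      (p ≠ .zend ∧ (∀ ℓ, p ≠ .loc ℓ) ∧ p' = p) := by
  cases p <;> simp [Responds, PV, Protocol.R]
  grind

theorem responds_dec {V : VASS L X} {lf : L} {x : X} {p p' : PVSt L X} :
    Responds V lf (.dec x) p p' ↔ (p = .zend ∧ p' = .err') ∨
      (∃ ℓ, p = .loc ℓ ∧ (p' = .frown ∨ ∃ ℓ' δ, (ℓ, δ, ℓ') ∈ V.Δ ∧ δ x = -1 ∧ p' = .loc ℓ')) ∨
      (p ≠ .zend ∧ (∀ ℓ, p ≠ .loc ℓ) ∧ p' = p) := by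
  cases p <;> simp [Responds, PV, Protocol.R]
  grind

/-- The broadcast transitions of `P_V`. -/
def Sends (V : VASS L X) (p : PVSt L X) (a : PVMsg X) (p' : PVSt L X) : Prop :=
  (p = .qin ∧ a = .start ∧ p' = .loc V.init) ∨ (p = .qin ∧ a = .dollar ∧ p' = .q1) ∨
  (∃ x, p = .zro ∧ a = .inc x ∧ p' = .unit x) ∨ (∃ x, p = .unit x ∧ a = .dec x ∧ p' = .zro) ∨
  (p = .zro ∧ a = .fin ∧ p' = .zend) ∨ (p = .lf' ∧ a = .verif ∧ p' = .qf)

theorem send_mem_iff {V : VASS L X} {lf : L} {p p' : PVSt L X} {a : PVMsg X} :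
    (p, Act.send a, p') ∈ (PV V lf).T ↔ Sends V p a p' := by
  simp [PV, Sends]

theorem stepAny_iff {V : VASS L X} {lf : L} {n : ℕ} {C C' : Fin n → PVSt L X} :
    (PV V lf).StepAny C C' ↔
      ∃ s a, Sends V (C s) a (C' s) ∧ ∀ e, e ≠ s → Responds V lf a (C e) (C' e) := by
  constructor
  · rintro ⟨s, t, q, a, q', rfl, ht, rfl, rfl, h⟩
    exact ⟨s, a, send_mem_iff.1 ht, h⟩
  · rintro ⟨s, a, hs, h⟩
    exact ⟨s, _, _, a, _, rfl, send_mem_iff.2 hs, rfl, rfl, h⟩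

open Classical in
/-- The number of participants in state `q`. -/
noncomputable def count {n : ℕ} (C : Fin n → PVSt L X) (q : PVSt L X) : ℕ :=
  (Finset.univ.filter fun e => C e = q).card

theorem count_congr {n : ℕ} {C C' : Fin n → PVSt L X} {q : PVSt L X}
    (h : ∀ e, C' e = q ↔ C e = q) : count C' q = count C q := by
  unfold count
  congr 1
  ext e
  simp [h e]

theorem count_eq_zero {n : ℕ} {C : Fin n → PVSt L X} {q : PVSt L X} :
    count C q = 0 ↔ ∀ e, C e ≠ q := by
  simp [count, Finset.filter_eq_empty_iff]

theorem count_succ {n : ℕ} {C C' : Fin n → PVSt L X} {q : PVSt L X} (s : Fin n)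
    (hs : C s ≠ q) (hs' : C' s = q) (h : ∀ e, e ≠ s → (C' e = q ↔ C e = q)) :
    count C' q = count C q + 1 := by
  classical
  unfold count
  rw [← Finset.card_insert_of_notMem (a := s) (by simpa using hs)]
  congr 1
  ext e
  by_cases he : e = s
  · simp [he, hs']
  · simp [he, h e he]

/-- The states of a participant that stores one potential counter unit. -/
def IsStore (p : PVSt L X) : Prop := p = .zro ∨ p = .zend ∨ ∃ x, p = .unit x

/-- Once some storing participant has ended, none holds a counter unit. -/
def EndedClean {n : ℕ} (C : Fin n → PVSt L X) : Prop :=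
  (∃ e, C e = .zend) → ∀ e x, C e ≠ .unit x

/-- An over-approximation of the configurations from which everyone can gather in `q_f`,
strong enough to extract a run of the VASS from an initial configuration in it. -/
def Viable (V : VASS L X) (lf : L) {n : ℕ} (C : Fin n → PVSt L X) : Prop :=
  (∀ e, C e = .qf) ∨
  (∃ s, C s = .lf' ∧ (∀ e, e ≠ s → IsStore (C e)) ∧ EndedClean C) ∨
  (∃ s ℓ, C s = .loc ℓ ∧ (∀ e, e ≠ s → IsStore (C e)) ∧ EndedClean C ∧
    V.Reach (ℓ, fun x => count C (.unit x)) (lf, 0)) ∨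
  ((∃ s, C s = .qin) ∧ (∀ e, C e = .qin ∨ C e = .q1 ∨ IsStore (C e)) ∧
    ((∀ e, C e = .qin ∨ C e = .q1) → V.Reach (V.init, 0) (lf, 0)))

theorem Viable.of_all_qf {V : VASS L X} {lf : L} {n : ℕ} {C C' : Fin n → PVSt L X}
    (h : (PV V lf).StepAny C C') (hC' : ∀ e, C' e = .qf) : Viable V lf C := by
  obtain ⟨s, a, hs, hr⟩ := stepAny_iff.1 h
  rcases hs with ⟨_, _, h3⟩ | ⟨_, _, h3⟩ | ⟨x, _, _, h3⟩ | ⟨x, _, _, h3⟩ | ⟨_, _, h3⟩ |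
    ⟨h1, rfl, h3⟩ <;> simp only [hC', reduceCtorEq] at h3
  have hz : ∀ e, e ≠ s → C e = .zend := by
    intro e he
    have := responds_verif.1 (hr e he)
    grind
  refine .inr (.inl ⟨s, h1, fun e he => .inr (.inl (hz e he)), fun _ e x hx => ?_⟩)
  grind

theorem EndedClean.of_forall_ne {n : ℕ} {C : Fin n → PVSt L X} (h : ∀ e, C e ≠ .zend) :
    EndedClean C :=
  fun ⟨e, he⟩ => absurd he (h e)

theorem Viable.of_lf' {V : VASS L X} {lf : L} {n : ℕ} {C C' : Fin n → PVSt L X}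
    (h : (PV V lf).StepAny C C') {l : Fin n} (hl : C' l = .lf')
    (hst : ∀ e, e ≠ l → IsStore (C' e)) (hcl : EndedClean C') : Viable V lf C := by
  obtain ⟨s, a, hs, hr⟩ := stepAny_iff.1 h
  have hsl : s ≠ l := by
    rintro rfl
    simp [Sends, hl] at hs
  have hst_s := hst s hsl
  rcases hs with ⟨_, _, h3⟩ | ⟨_, _, h3⟩ | ⟨x, h1, rfl, h3⟩ | ⟨x, h1, rfl, h3⟩ | ⟨h1, rfl, h3⟩ |
    ⟨h1, rfl, h3⟩ <;> simp [h3, IsStore] at hst_s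
  · simp only [responds_inc] at hr
    refine .inr (.inl ⟨l, by grind, fun e he => ?_, .of_forall_ne fun e => ?_⟩) <;>
      grind [IsStore]
  · simp only [responds_dec] at hr
    refine .inr (.inl ⟨l, by grind, fun e he => ?_, .of_forall_ne fun e => ?_⟩) <;>
      grind [IsStore]
  · simp only [responds_fin] at hr
    have hu := hcl ⟨s, h3⟩
    have hu' : ∀ e x, C e ≠ .unit x := by grind
    have hst' : ∀ e, e ≠ l → IsStore (C e) := by grind [IsStore]
    rcases hr l hsl.symm with ⟨hlf, _⟩ | ⟨_, hlf⟩
    · refine .inr (.inr (.inl ⟨l, lf, hlf, hst', fun _ => hu', ?_⟩))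
      have : (fun x => count C (.unit x)) = 0 := funext fun x => count_eq_zero.2 fun e => hu' e x
      rw [this]
      exact .refl
    · exact .inr (.inl ⟨l, hlf ▸ hl, hst', fun _ => hu'⟩)

theorem Viable.of_loc {V : VASS L X} {lf : L} (hunit : UnitVASS V) {n : ℕ}
    {C C' : Fin n → PVSt L X} (h : (PV V lf).StepAny C C') {l : Fin n} {ℓ : L}
    (hl : C' l = .loc ℓ) (hst : ∀ e, e ≠ l → IsStore (C' e)) (hcl : EndedClean C')
    (hreach : V.Reach (ℓ, fun x => count C' (.unit x)) (lf, 0)) : Viable V lf C := by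
  obtain ⟨s, a, hs, hr⟩ := stepAny_iff.1 h
  by_cases hsl : s = l
  · subst hsl
    simp [Sends, hl] at hs
    obtain ⟨h1, rfl, rfl⟩ := hs
    simp only [responds_start] at hr
    refine .inr (.inr (.inr ⟨⟨s, h1⟩, fun e => by grind [IsStore], fun hall => ?_⟩))
    have : (fun x => count C' (.unit x)) = 0 :=
      funext fun x => count_eq_zero.2 fun e => by grind
    rwa [this] at hreach
  have hst_s := hst s hsl
  rcases hs with ⟨_, _, h3⟩ | ⟨_, _, h3⟩ | ⟨x, h1, rfl, h3⟩ | ⟨x, h1, rfl, h3⟩ | ⟨h1, rfl, h3⟩ |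
    ⟨h1, rfl, h3⟩ <;> simp [h3, IsStore] at hst_s
  · simp only [responds_inc] at hr
    obtain ⟨ℓ₀, δ, hl₀, hδ, hx⟩ : ∃ ℓ₀ δ, C l = .loc ℓ₀ ∧ (ℓ₀, δ, ℓ) ∈ V.Δ ∧ δ x = 1 := by
      have := hr l (Ne.symm hsl)
      grind
    have hrest : ∀ e, e ≠ s → e ≠ l → C' e = C e := by grind [IsStore]
    refine .inr (.inr (.inl ⟨l, ℓ₀, hl₀, fun e he => by grind [IsStore],
      .of_forall_ne fun e => by grind, .head ⟨δ, hδ, fun y => ?_⟩ hreach⟩))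
    by_cases hy : y = x
    · subst hy
      rw [hx]
      exact_mod_cast count_succ s (by grind) h3 (by grind)
    · have : δ y = 0 := by
        obtain ⟨z, hz, hz'⟩ := hunit _ hδ
        grind
      simp only [this, add_zero]
      exact_mod_cast count_congr (by grind)
  · simp only [responds_dec] at hr
    obtain ⟨ℓ₀, δ, hl₀, hδ, hx⟩ : ∃ ℓ₀ δ, C l = .loc ℓ₀ ∧ (ℓ₀, δ, ℓ) ∈ V.Δ ∧ δ x = -1 := by
      have := hr l (Ne.symm hsl)
      grind
    have hrest : ∀ e, e ≠ s → e ≠ l → C' e = C e := by grind [IsStore]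
    refine .inr (.inr (.inl ⟨l, ℓ₀, hl₀, fun e he => by grind [IsStore],
      .of_forall_ne fun e => by grind, .head ⟨δ, hδ, fun y => ?_⟩ hreach⟩))
    by_cases hy : y = x
    · subst hy
      have : count C (.unit y) = count C' (.unit y) + 1 :=
        count_succ s (by grind) h1 (by grind)
      simp only [hx, this]
      push_cast
      ring
    · have : δ y = 0 := by
        obtain ⟨z, hz, hz'⟩ := hunit _ hδ
        grind
      simp only [this, add_zero]
      exact_mod_cast count_congr (by grind)
  · simp only [responds_fin] at hr
    have hu := hcl ⟨s, h3⟩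
    have hrest : ∀ e, e ≠ s → C' e = C e := by grind [IsStore]
    refine .inr (.inr (.inl ⟨l, ℓ, by grind, fun e he => by grind [IsStore],
      fun _ => by grind, ?_⟩))
    have : (fun x => count C' (.unit x)) = fun x => count C (.unit x) :=
      funext fun x => count_congr (by grind)
    rwa [this] at hreach

theorem Viable.of_qin {V : VASS L X} {lf : L} {n : ℕ} {C C' : Fin n → PVSt L X}
    (h : (PV V lf).StepAny C C') {l : Fin n} (hl : C' l = .qin)
    (hst : ∀ e, C' e = .qin ∨ C' e = .q1 ∨ IsStore (C' e))
    (hreach : (∀ e, C' e = .qin ∨ C' e = .q1) → V.Reach (V.init, 0) (lf, 0)) :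
    Viable V lf C := by
  obtain ⟨s, a, hs, hr⟩ := stepAny_iff.1 h
  have hsl : s ≠ l := by
    rintro rfl
    simp [Sends, hl] at hs
  have hst_s := hst s
  rcases hs with ⟨_, _, h3⟩ | ⟨h1, rfl, h3⟩ | ⟨x, h1, rfl, h3⟩ | ⟨x, h1, rfl, h3⟩ |
    ⟨h1, rfl, h3⟩ | ⟨h1, rfl, h3⟩ <;> simp [h3, IsStore] at hst_s
  · simp only [responds_dollar] at hr
    exact .inr (.inr (.inr ⟨⟨s, h1⟩, by grind, fun hall => hreach (by grind)⟩))
  · simp only [responds_inc] at hr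
    exact .inr (.inr (.inr ⟨⟨l, by grind⟩, by grind [IsStore], by grind⟩))
  · simp only [responds_dec] at hr
    exact .inr (.inr (.inr ⟨⟨l, by grind⟩, by grind [IsStore], by grind⟩))
  · simp only [responds_fin] at hr
    exact .inr (.inr (.inr ⟨⟨l, by grind⟩, by grind [IsStore], by grind⟩))

theorem viable_of_reach {V : VASS L X} {lf : L} (hunit : UnitVASS V) {n : ℕ}
    {C Cf : Fin n → PVSt L X} (h : (PV V lf).Reach C Cf) (hf : ∀ e, Cf e = .qf) :
    Viable V lf C := by
  induction h using Relation.ReflTransGen.head_induction_on with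
  | refl => exact .inl hf
  | head hstep _ ih =>
    rcases ih with hq | ⟨l, hl, hst, hcl⟩ | ⟨l, ℓ, hl, hst, hcl, hr⟩ | ⟨⟨l, hl⟩, hst, hr⟩
    · exact .of_all_qf hstep hq
    · exact .of_lf' hstep hl hst hcl
    · exact .of_loc hunit hstep hl hst hcl hr
    · exact .of_qin hstep hl hst hr

/-- All participants can gather in `q_f` from `C`. -/
def CanSync (V : VASS L X) (lf : L) {n : ℕ} (C : Fin n → PVSt L X) : Prop :=
  ∃ Cf, (PV V lf).Reach C Cf ∧ ∀ e, Cf e = .qf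

theorem CanSync.of_step {V : VASS L X} {lf : L} {n : ℕ} {C C' : Fin n → PVSt L X}
    (h : CanSync V lf C') (s : Fin n) (a : PVMsg X) (hs : Sends V (C s) a (C' s))
    (hr : ∀ e, e ≠ s → Responds V lf a (C e) (C' e)) : CanSync V lf C := by
  obtain ⟨Cf, h, hf⟩ := h
  exact ⟨Cf, .head (stepAny_iff.2 ⟨s, a, hs, hr⟩) h, hf⟩

theorem canSync_of_lf' {V : VASS L X} {lf : L} {n : ℕ} {C : Fin n → PVSt L X} {l : Fin n}
    (hl : C l = .lf') (hst : ∀ e, e ≠ l → C e = .zro ∨ C e = .zend) : CanSync V lf C := by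
  classical
  induction hk : count C .zro generalizing C with
  | zero =>
    have hz := count_eq_zero.1 hk
    refine CanSync.of_step (C' := fun _ => .qf) ⟨_, .refl, fun _ => rfl⟩ l .verif
      (by simp [Sends, hl]) fun e he => responds_verif.2 ?_
    grind
  | succ k ih =>
    obtain ⟨s, hs⟩ : ∃ s, C s = .zro := by
      by_contra! h
      simp [count_eq_zero.2 h] at hk
    have hsl : l ≠ s := by grind
    refine CanSync.of_step (C' := Function.update C s .zend) (ih ?_ ?_ ?_) s .fin
      (by simp [Sends, hs]) fun e he => responds_fin.2 ?_
    · grind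
    · grind
    · have : count C .zro = count (Function.update C s .zend) .zro + 1 :=
        count_succ s (by simp) hs (by grind)
      omega
    · grind

theorem exists_canSync_of_reach {V : VASS L X} {lf : L} (hunit : UnitVASS V) {c : L × (X → ℕ)}
    (h : V.Reach c (lf, 0)) :
    ∃ K, ∀ (n : ℕ) (C : Fin n → PVSt L X) (l : Fin n), C l = .loc c.1 →
      (∀ e, e ≠ l → C e = .zro ∨ ∃ x, C e = .unit x) → (∀ x, count C (.unit x) = c.2 x) →
      K ≤ count C .zro → CanSync V lf C := by
  classical
  induction h using Relation.ReflTransGen.head_induction_on with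
  | refl =>
    refine ⟨1, fun n C l hl hst hu hk => ?_⟩
    have hu' : ∀ x e, C e ≠ .unit x := fun x => count_eq_zero.1 (hu x)
    obtain ⟨s, hs⟩ : ∃ s, C s = .zro := by
      by_contra! h
      simp [count_eq_zero.2 h] at hk
    have hsl : l ≠ s := by grind
    refine CanSync.of_step (C' := Function.update (Function.update C l .lf') s .zend)
      (canSync_of_lf' (l := l) (by grind) (by grind)) s .fin
      (by simp [Sends, hs]) fun e he => responds_fin.2 ?_
    grind
  | @head c c' hstep _ ih =>
    obtain ⟨K, ih⟩ := ih
    obtain ⟨δ, hδ, hv⟩ := hstep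
    obtain ⟨x, hx, hx'⟩ := hunit _ hδ
    simp only at hx hx'
    refine ⟨K + 1, fun n C l hl hst hu hk => ?_⟩
    rcases hx with hx | hx
    · obtain ⟨s, hs⟩ : ∃ s, C s = .zro := by
        by_contra! h
        simp [count_eq_zero.2 h] at hk
      have hsl : l ≠ s := by grind
      refine CanSync.of_step (C' := Function.update (Function.update C l (.loc c'.1)) s (.unit x))
        (ih n _ l (by grind) (by grind) (fun y => ?_) ?_) s (.inc x)
        (by simp [Sends, hs]) fun e he => responds_inc.2 ?_
      · have hvy := hv y
        by_cases hy : y = x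
        · subst hy
          rw [count_succ (C := C) s (by grind) (by grind) (by grind)]
          grind
        · rw [count_congr (C := C) (by grind)]
          grind
      · have : count C .zro =
            count (Function.update (Function.update C l (.loc c'.1)) s (.unit x)) .zro + 1 :=
          count_succ s (by grind) hs (by grind)
        omega
      · grind
    · obtain ⟨s, hs⟩ : ∃ s, C s = .unit x := by
        by_contra! h
        have hvx := hv x
        have hux := hu x
        rw [count_eq_zero.2 h] at hux
        omega
      have hsl : l ≠ s := by grind
      refine CanSync.of_step (C' := Function.update (Function.update C l (.loc c'.1)) s .zro)
        (ih n _ l (by grind) (by grind) (fun y => ?_) ?_) s (.dec x)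
        (by simp [Sends, hs]) fun e he => responds_dec.2 ?_
      · have hvy := hv y
        by_cases hy : y = x
        · subst hy
          have : count C (.unit y) =
              count (Function.update (Function.update C l (.loc c'.1)) s .zro) (.unit y) + 1 :=
            count_succ s (by grind) hs (by grind)
          grind
        · rw [count_congr (C := C) (by grind)]
          grind
      · rw [count_succ (C := C) s (by grind) (by grind) (by grind)]
        omega
      · grind

theorem canSync_of_qin {V : VASS L X} {lf : L} {n : ℕ} {C : Fin n → PVSt L X} {l : Fin n}
    (hl : C l = .qin) (hst : ∀ e, e ≠ l → C e = .qin ∨ C e = .q1)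
    (hsync : CanSync V lf fun e => if e = l then .loc V.init else .zro) : CanSync V lf C := by
  classical
  induction hk : count C .qin generalizing C with
  | zero => exact absurd hl (count_eq_zero.1 hk l)
  | succ k ih =>
    by_cases h : ∃ s, s ≠ l ∧ C s = .qin
    · obtain ⟨s, hsl, hs⟩ := h
      refine CanSync.of_step (C' := Function.update C s .q1) (ih ?_ ?_ ?_) s .dollar
        (by simp [Sends, hs]) fun e he => responds_dollar.2 ?_
      · grind
      · grind
      · have : count C .qin = count (Function.update C s .q1) .qin + 1 :=
          count_succ s (by simp) hs (by grind)
        omega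
      · grind
    · refine hsync.of_step l .start (by simp [Sends, hl]) fun e he => responds_start.2 ?_
      grind

end PV

/-- **Correctness of the Ackermann-hardness reduction.** All processes of `P_V` can
gather in `q_f` iff `(ℓ_0, 0) ⇝* (ℓ_f, 0)` in the VASS `V`. -/
theorem synchro_iff_vass_zero_reach {L X : Type} [Fintype L] [Fintype X]
    (V : VASS L X) (lf : L) (hunit : UnitVASS V) :
    (∃ (n : ℕ), 0 < n ∧ ∃ C0 Cf : Fin n → PVSt L X,
       (PV V lf).Initial C0 ∧ (PV V lf).Reach C0 Cf ∧ ∀ e, Cf e = PVSt.qf) ↔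
    V.Reach (V.init, 0) (lf, 0) := by
  constructor
  · rintro ⟨n, hn, C0, Cf, h0, hreach, hf⟩
    have h0 : ∀ e, C0 e = .qin := h0
    rcases PV.viable_of_reach hunit hreach hf with h | ⟨l, hl, -⟩ | ⟨l, ℓ, hl, -⟩ | ⟨-, -, h⟩
    · simpa [h0] using h ⟨0, hn⟩
    · simp [h0] at hl
    · simp [h0] at hl
    · exact h fun e => .inl (h0 e)
  · intro h
    obtain ⟨K, hK⟩ := PV.exists_canSync_of_reach hunit h
    have hstart : PV.CanSync V lf
        fun e : Fin (K + 1) => if e = 0 then .loc V.init else .zro := by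
      refine hK _ _ 0 (by simp) (by grind) (fun x => PV.count_eq_zero.2 (by grind)) ?_
      have : PV.count (fun e : Fin (K + 1) => if e = 0 then .loc V.init else .zro)
          (.zro : PVSt L X) = ({0}ᶜ : Finset (Fin (K + 1))).card := by
        unfold PV.count
        congr 1
        ext e
        by_cases he : e = 0 <;> simp [he]
      rw [this]
      simp [Finset.card_compl]
    obtain ⟨Cf, hreach, hf⟩ :=
      PV.canSync_of_qin (C := fun _ => .qin) (l := 0) rfl (fun _ _ => .inl rfl) hstart
    exact ⟨K + 1, K.succ_pos, _, Cf, fun _ => rfl, hreach, hf⟩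
end

section
/- Let V = (Loc, ℓ_0, X, Δ) be a VASS in which every transition changes exactly one counter by exactly ±1, let ℓ_f ∈ Loc, and let P_V be the Wait-Only protocol built from V. Let C_0 → C_1 → … → C_n be a finite execution of P_V with C_0 initial and C_n(e) = q_f for all e ∈ [1, ||C_n||]. Then there is exactly one index 0 ≤ j < n such that the step from C_j to C_{j+1} is performed via the broadcast transition (ℓ'_f, !!verif, q_f), i.e., the message verif is broadcast exactly once along the execution. -/
set_option maxHeartbeats 1000000

namespace PV

variable {L X : Type} {V : VASS L X} {lf : L} {n : ℕ} {e f : Fin n}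
  {t : PVSt L X × Act (PVMsg X) × PVSt L X} {C C' : Fin n → PVSt L X}

/-- A process can enter `q_f` only when `verif` is broadcast. -/
theorem eq_verif_of_step_qf (h : (PV V lf).Step e t C C') (hC : C f ≠ .qf) (hC' : C' f = .qf) :
    t = (.lf', .send .verif, .qf) := by
  obtain ⟨q, a, q', rfl, ht, rfl, rfl, hr⟩ := h
  by_cases hf : f = e
  · subst hf
    simp_all [PV]
  · rcases hr f hf with h | ⟨-, h⟩
    · simp_all [PV]
    · exact absurd (h.symm.trans hC') hC

/-- The state `err` is a sink. -/
theorem step_err (h : (PV V lf).Step e t C C') (hC : C f = .err) : C' f = .err := by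
  obtain ⟨q, a, q', rfl, ht, rfl, rfl, hr⟩ := h
  by_cases hf : f = e
  · subst hf
    simp_all [PV]
  · rcases hr f hf with h | ⟨-, h⟩
    · simp_all [PV]
    · exact h.trans hC

/-- From `q_f`, a process either stays or moves to `err`. -/
theorem step_qf (h : (PV V lf).Step e t C C') (hC : C f = .qf) : C' f = .qf ∨ C' f = .err := by
  obtain ⟨q, a, q', rfl, ht, rfl, rfl, hr⟩ := h
  by_cases hf : f = e
  · subst hf
    simp_all [PV]
  · rcases hr f hf with h | ⟨-, h⟩
    · simp_all [PV]
    · exact .inl (h.trans hC)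

/-- A broadcast of `verif` sends every process in `q_f` to `err`. -/
theorem step_verif_qf (h : (PV V lf).Step e (.lf', .send .verif, .qf) C C') (hC : C f = .qf) :
    C' f = .err := by
  obtain ⟨q, a, q', ht, -, hq, -, hr⟩ := h
  simp only [Prod.mk.injEq, Act.send.injEq] at ht
  obtain ⟨rfl, rfl, rfl⟩ := ht
  have hf : f ≠ e := by
    rintro rfl
    simp [hC] at hq
  rcases hr f hf with h | ⟨h, -⟩
  · simpa [PV, hC] using h
  · simp [PV, Protocol.R, hC] at h

section Execution

variable {N : ℕ} {ρ : ℕ → Fin n → PVSt L X} {es : ℕ → Fin n}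
  {ts : ℕ → PVSt L X × Act (PVMsg X) × PVSt L X}

theorem err_of_le (hstep : ∀ i < N, (PV V lf).Step (es i) (ts i) (ρ i) (ρ (i + 1)))
    {i k : ℕ} (hik : i ≤ k) (hk : k ≤ N) (hi : ρ i f = .err) : ρ k f = .err := by
  induction k, hik using Nat.le_induction with
  | base => exact hi
  | succ k _ ih => exact step_err (hstep k hk) (ih (Nat.le_of_succ_le hk))

theorem qf_or_err_of_le (hstep : ∀ i < N, (PV V lf).Step (es i) (ts i) (ρ i) (ρ (i + 1)))
    {i k : ℕ} (hik : i ≤ k) (hk : k ≤ N) (hi : ρ i f = .qf) : ρ k f = .qf ∨ ρ k f = .err := by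
  induction k, hik using Nat.le_induction with
  | base => exact .inl hi
  | succ k _ ih =>
    rcases ih (Nat.le_of_succ_le hk) with h | h
    · exact step_qf (hstep k hk) h
    · exact .inr (step_err (hstep k hk) h)

theorem exists_verif (hstep : ∀ i < N, (PV V lf).Step (es i) (ts i) (ρ i) (ρ (i + 1)))
    (h0 : ρ 0 f ≠ .qf) (hN : ρ N f = .qf) :
    ∃ j < N, ts j = (.lf', .send .verif, .qf) := by
  by_contra! hno
  have hne : ∀ k ≤ N, ρ k f ≠ .qf := by
    intro k
    induction k with
    | zero => exact fun _ => h0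
    | succ k ih =>
      exact fun hk h => hno k hk (eq_verif_of_step_qf (hstep k hk) (ih (Nat.le_of_succ_le hk)) h)
  exact hne N le_rfl hN

/-- After two broadcasts of `verif`, the first broadcaster ends up in `err`. -/
theorem err_of_verif_of_verif
    (hstep : ∀ i < N, (PV V lf).Step (es i) (ts i) (ρ i) (ρ (i + 1)))
    {i j : ℕ} (hij : i < j) (hj : j < N) (hi' : ts i = (.lf', .send .verif, .qf))
    (hj' : ts j = (.lf', .send .verif, .qf)) : ρ N (es i) = .err := by
  have hqf : ρ (i + 1) (es i) = .qf := by
    obtain ⟨q, a, q', ht, -, -, hq', -⟩ := hstep i (hij.trans hj)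
    simp_all
  rcases qf_or_err_of_le hstep hij hj.le hqf with h | h
  · exact err_of_le hstep hj le_rfl (step_verif_qf (hj' ▸ hstep j hj) h)
  · exact err_of_le hstep hj.le le_rfl h

end Execution

end PV

/-- **Uniqueness of the `verif` broadcast.** In any finite execution of `P_V` (given with
its witnessing processes and transitions) that gathers all processes in `q_f`, the
broadcast transition `(ℓ'_f, !!verif, q_f)` is used at exactly one step. -/
theorem verif_broadcast_unique {L X : Type} [Fintype L] [Fintype X]
    (V : VASS L X) (lf : L) (hunit : UnitVASS V)
    {n : ℕ} (hn : 0 < n) (N : ℕ)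
    (ρ : ℕ → Fin n → PVSt L X)
    (es : ℕ → Fin n) (ts : ℕ → PVSt L X × Act (PVMsg X) × PVSt L X)
    (hinit : (PV V lf).Initial (ρ 0))
    (hstep : ∀ i < N, (PV V lf).Step (es i) (ts i) (ρ i) (ρ (i + 1)))
    (hfin : ∀ e, ρ N e = PVSt.qf) :
    ∃! j : ℕ, j < N ∧ ts j = (PVSt.lf', Act.send PVMsg.verif, PVSt.qf) := by
  obtain ⟨j, hj, htj⟩ := PV.exists_verif (f := ⟨0, hn⟩) hstep (by simp [hinit _, PV]) (hfin _)
  refine ⟨j, ⟨hj, htj⟩, ?_⟩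
  rintro i ⟨hi, hti⟩
  rcases lt_trichotomy i j with hij | hij | hij
  · simpa [hfin] using PV.err_of_verif_of_verif hstep hij hj hti htj
  · exact hij
  · simpa [hfin] using PV.err_of_verif_of_verif hstep hij hi htj hti
end
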